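/- arXiv:1803.10832 — 2 statements merged into one kernel-verified Lean document; each statement's English description precedes it below -/
import Mathlib

section
/- Let α be a real number with α > −1/2 which is not an integer, and set c_α := 2^α / Γ(−α). Then, as n → +∞, the Fourier coefficients of φ_α satisfy φ̂_α(n) = c_α · n^{−α−1} + o(n^{−α−1}), and φ̂_α(−n) = (−1)^n c_α · n^{−α−1} + o(n^{−α−1}). -/
open MeasureTheory Filter Asymptotics

/-- The `n`-th Fourier coefficient of `φ_α(θ) = (1-e^{iθ})^α (1+e^{-iθ})^α`
(principal branch complex powers). -/
noncomputable def phiHat (α : ℝ) (n : ℤ) : ℂ :=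
  (1 / (2 * (Real.pi : ℂ))) * ∫ θ in (-Real.pi)..Real.pi,
    (1 - Complex.exp ((θ : ℂ) * Complex.I)) ^ (α : ℂ) *
      (1 + Complex.exp (-(θ : ℂ) * Complex.I)) ^ (α : ℂ) *
      Complex.exp (-(n : ℂ) * (θ : ℂ) * Complex.I)

lemma integral_Ioo_mul_one_sub_rpow {a : ℝ} (ha : 0 < a) :
    IntegrableOn (fun x : ℝ => (x * (1 - x)) ^ (a - 1)) (Set.Ioo 0 1) ∧
      ∫ x in Set.Ioo (0 : ℝ) 1, (x * (1 - x)) ^ (a - 1) =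
        Real.Gamma a ^ 2 / Real.Gamma (2 * a) := by
  have key : Set.EqOn (fun x : ℝ => (x : ℂ) ^ ((a : ℂ) - 1) * (1 - (x : ℂ)) ^ ((a : ℂ) - 1))
      (fun x : ℝ => (((x * (1 - x)) ^ (a - 1) : ℝ) : ℂ)) (Set.Ioo 0 1) := by
    intro x hx
    have h0 : 0 ≤ x := hx.1.le
    have h1 : 0 ≤ 1 - x := by linarith [hx.2]
    simp only
    rw [Real.mul_rpow h0 h1, Complex.ofReal_mul, Complex.ofReal_cpow h0, Complex.ofReal_cpow h1]
    push_cast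
    rfl
  have hint := Complex.betaIntegral_convergent (u := a) (v := a) (by simpa) (by simpa)
  rw [intervalIntegrable_iff_integrableOn_Ioo_of_le zero_le_one] at hint
  have hint2 := hint.congr_fun key measurableSet_Ioo
  have hint3 : IntegrableOn (fun x : ℝ => (x * (1 - x)) ^ (a - 1)) (Set.Ioo 0 1) := by
    simpa using! hint2.re
  refine ⟨hint3, ?_⟩
  have h := Complex.betaIntegral_eq_Gamma_mul_div a a (by simpa) (by simpa)
  rw [Complex.betaIntegral, intervalIntegral.integral_of_le zero_le_one,
    integral_Ioc_eq_integral_Ioo, setIntegral_congr_fun measurableSet_Ioo key,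
    integral_complex_ofReal] at h
  rw [← Complex.ofReal_inj, h, ← Complex.ofReal_add, Complex.Gamma_ofReal, Complex.Gamma_ofReal]
  push_cast
  rw [sq, two_mul]

lemma image_half_one_sub_cos_Ioo :
    (fun θ : ℝ => (1 - Real.cos θ) / 2) '' Set.Ioo 0 Real.pi = Set.Ioo 0 1 := by
  ext x
  constructor
  · rintro ⟨θ, hθ, rfl⟩
    have h1 := Real.cos_lt_cos_of_nonneg_of_le_pi le_rfl hθ.2.le hθ.1
    have h2 := Real.cos_lt_cos_of_nonneg_of_le_pi hθ.1.le le_rfl hθ.2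
    simp only [Real.cos_zero, Real.cos_pi] at h1 h2
    constructor <;> simp only <;> linarith
  · intro hx
    refine ⟨Real.arccos (1 - 2 * x), ⟨Real.arccos_pos.2 (by linarith [hx.1]), ?_⟩, ?_⟩
    · refine lt_of_le_of_ne (Real.arccos_le_pi _) fun h => ?_
      rw [Real.arccos_eq_pi] at h
      linarith [hx.2]
    · simp only
      rw [Real.cos_arccos (by linarith [hx.2]) (by linarith [hx.1])]
      ring

lemma integrableOn_sin_rpow_and_integral_eq {β : ℝ} (hβ : -1 < β) :
    IntegrableOn (fun θ : ℝ => Real.sin θ ^ β) (Set.Ioo 0 Real.pi) ∧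
      ∫ θ in Set.Ioo 0 Real.pi, Real.sin θ ^ β =
        2 ^ β * (Real.Gamma ((β + 1) / 2) ^ 2 / Real.Gamma (β + 1)) := by
  obtain ⟨h1, h2⟩ := integral_Ioo_mul_one_sub_rpow (a := (β + 1) / 2) (by linarith)
  have hd : ∀ θ ∈ Set.Ioo 0 Real.pi, HasDerivWithinAt (fun θ : ℝ => (1 - Real.cos θ) / 2)
      (Real.sin θ / 2) (Set.Ioo 0 Real.pi) θ := fun θ _ => by
    simpa using! (((Real.hasDerivAt_cos θ).const_sub 1).div_const 2).hasDerivWithinAt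
  have hinj : Set.InjOn (fun θ : ℝ => (1 - Real.cos θ) / 2) (Set.Ioo 0 Real.pi) := by
    intro x hx y hy h
    exact Real.injOn_cos ⟨hx.1.le, hx.2.le⟩ ⟨hy.1.le, hy.2.le⟩ (by simp only at h; linarith)
  have key : Set.EqOn (fun θ : ℝ => |Real.sin θ / 2| •
        ((1 - Real.cos θ) / 2 * (1 - (1 - Real.cos θ) / 2)) ^ ((β + 1) / 2 - 1))
      (fun θ : ℝ => (2 ^ β)⁻¹ * Real.sin θ ^ β) (Set.Ioo 0 Real.pi) := by
    intro θ hθ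
    have hs := Real.sin_pos_of_mem_Ioo hθ
    have e : (1 - Real.cos θ) / 2 * (1 - (1 - Real.cos θ) / 2) = (Real.sin θ / 2) ^ (2 : ℝ) := by
      rw [Real.rpow_two]
      nlinarith [Real.sin_sq_add_cos_sq θ]
    simp only [smul_eq_mul]
    rw [e, abs_of_pos (by positivity), ← Real.rpow_mul (by positivity)]
    nth_rewrite 1 [← Real.rpow_one (Real.sin θ / 2)]
    rw [← Real.rpow_add (by positivity), Real.div_rpow hs.le zero_le_two, div_eq_inv_mul]
    congr 2 <;> ring_nf
  rw [← image_half_one_sub_cos_Ioo] at h1 h2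
  rw [integrableOn_image_iff_integrableOn_abs_deriv_smul measurableSet_Ioo hd hinj] at h1
  rw [integral_image_eq_integral_abs_deriv_smul measurableSet_Ioo hd hinj,
    setIntegral_congr_fun measurableSet_Ioo key, integral_const_mul] at h2
  have h3 := h1.congr_fun key measurableSet_Ioo
  have h2β : (2 : ℝ) ^ β ≠ 0 := by positivity
  constructor
  · have := h3.const_mul (2 ^ β)
    simpa only [mul_inv_cancel_left₀ h2β] using! this
  · rw [show 2 * ((β + 1) / 2) = β + 1 by ring] at h2
    rw [← h2, mul_inv_cancel_left₀ h2β]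

lemma intervalIntegrable_sin_rpow {β : ℝ} (hβ : -1 < β) :
    IntervalIntegrable (fun θ : ℝ => Real.sin θ ^ β) volume 0 Real.pi := by
  rw [intervalIntegrable_iff_integrableOn_Ioo_of_le Real.pi_pos.le]
  exact (integrableOn_sin_rpow_and_integral_eq hβ).1

lemma integral_sin_rpow_mul_Gamma {β : ℝ} (hβ : -1 < β) :
    (∫ θ in 0..Real.pi, Real.sin θ ^ β) * Real.Gamma (β / 2 + 1) =
      √Real.pi * Real.Gamma ((β + 1) / 2) := by
  rw [intervalIntegral.integral_of_le Real.pi_pos.le, integral_Ioc_eq_integral_Ioo,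
    (integrableOn_sin_rpow_and_integral_eq hβ).2]
  have h := Real.Gamma_mul_Gamma_add_half ((β + 1) / 2)
  rw [show (β + 1) / 2 + 1 / 2 = β / 2 + 1 by ring, show 2 * ((β + 1) / 2) = β + 1 by ring,
    show 1 - (β + 1) = -β by ring, Real.rpow_neg zero_le_two] at h
  have hG : Real.Gamma (β + 1) ≠ 0 := (Real.Gamma_pos_of_pos (by linarith)).ne'
  have h2β : (2 : ℝ) ^ β ≠ 0 := by positivity
  calc _ = 2 ^ β / Real.Gamma (β + 1) * Real.Gamma ((β + 1) / 2) *
        (Real.Gamma ((β + 1) / 2) * Real.Gamma (β / 2 + 1)) := by ring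
    _ = _ := by rw [h]; field_simp

/-- The integral of `sin θ ^ β * cos (c * θ + δ)` over `[0, π]`. -/
noncomputable def sinCosIntegral (β δ c : ℝ) : ℝ :=
  ∫ θ in 0..Real.pi, Real.sin θ ^ β * Real.cos (c * θ + δ)

lemma intervalIntegrable_sin_rpow_mul {β : ℝ} (hβ : -1 < β) {f : ℝ → ℝ} (hf : Continuous f) :
    IntervalIntegrable (fun θ : ℝ => Real.sin θ ^ β * f θ) volume 0 Real.pi :=
  (intervalIntegrable_sin_rpow hβ).mul_continuousOn hf.continuousOn

lemma sinCosIntegral_add_two {β : ℝ} (hβ : -1 < β) (δ c : ℝ) :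
    (c + 2 + β) * sinCosIntegral β δ (c + 2) = (c - β) * sinCosIntegral β δ c := by
  have hF : ∫ θ in 0..Real.pi, ((c + 2 + β) * (Real.sin θ ^ β * Real.cos ((c + 2) * θ + δ)) -
      (c - β) * (Real.sin θ ^ β * Real.cos (c * θ + δ))) =
      2 * (Real.sin Real.pi ^ (β + 1) * Real.cos ((c + 1) * Real.pi + δ)) -
      2 * (Real.sin 0 ^ (β + 1) * Real.cos ((c + 1) * 0 + δ)) := by
    refine intervalIntegral.integral_eq_sub_of_hasDerivAt_of_le
      (f := fun θ => 2 * (Real.sin θ ^ (β + 1) * Real.cos ((c + 1) * θ + δ))) Real.pi_pos.le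
      ?_ ?_ ?_
    · refine Continuous.continuousOn ?_
      exact continuous_const.mul ((Real.continuous_sin.rpow_const fun _ => Or.inr (by linarith)).mul
        (by fun_prop))
    · intro θ hθ
      have hs := Real.sin_pos_of_mem_Ioo hθ
      have h1 : HasDerivAt (fun θ : ℝ => (c + 1) * θ + δ) (c + 1) θ := by
        simpa using ((hasDerivAt_id θ).const_mul (c + 1)).add_const δ
      have h2 := (((Real.hasDerivAt_sin θ).rpow_const (p := β + 1) (Or.inl hs.ne')).mul
        h1.cos).const_mul 2
      convert! h2 using 1
      rw [show (c + 2) * θ + δ = ((c + 1) * θ + δ) + θ by ring,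
        show c * θ + δ = ((c + 1) * θ + δ) - θ by ring, Real.cos_add, Real.cos_sub,
        add_sub_cancel_right, Real.rpow_add_one hs.ne']
      ring
    · exact ((intervalIntegrable_sin_rpow_mul hβ (by fun_prop)).const_mul _).sub
        ((intervalIntegrable_sin_rpow_mul hβ (by fun_prop)).const_mul _)
  rw [intervalIntegral.integral_sub
    ((intervalIntegrable_sin_rpow_mul hβ (by fun_prop)).const_mul _)
    ((intervalIntegrable_sin_rpow_mul hβ (by fun_prop)).const_mul _),
    intervalIntegral.integral_const_mul, intervalIntegral.integral_const_mul, Real.sin_pi,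
    Real.sin_zero, Real.zero_rpow (by linarith)] at hF
  simp only [sinCosIntegral]
  linarith

lemma sinCosIntegral_neg_natCast (β δ : ℝ) (n : ℕ) :
    sinCosIntegral β δ (-n) = (-1) ^ n * sinCosIntegral β δ n := by
  have h := intervalIntegral.integral_comp_sub_left (a := 0) (b := Real.pi)
    (fun θ => Real.sin θ ^ β * Real.cos (-n * θ + δ)) Real.pi
  simp only [sub_zero, sub_self] at h
  rw [sinCosIntegral, sinCosIntegral, ← h, ← intervalIntegral.integral_const_mul]
  refine intervalIntegral.integral_congr fun θ _ => ?_
  rw [Real.sin_pi_sub, show -(n : ℝ) * (Real.pi - θ) + δ = n * θ + δ - n * Real.pi by ring,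
    Real.cos_sub_nat_mul_pi]
  ring

lemma sinCosIntegral_zero (β δ : ℝ) :
    sinCosIntegral β δ 0 = (∫ θ in 0..Real.pi, Real.sin θ ^ β) * Real.cos δ := by
  simp [sinCosIntegral]

lemma sinCosIntegral_one {β : ℝ} (hβ : -1 < β) (δ : ℝ) :
    sinCosIntegral β δ 1 = -(∫ θ in 0..Real.pi, Real.sin θ ^ (β + 1)) * Real.sin δ := by
  have h := sinCosIntegral_neg_natCast β δ 1
  have h0 : sinCosIntegral β δ 1 = (sinCosIntegral β δ 1 - sinCosIntegral β δ (-1)) / 2 := by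
    simp at h
    rw [h]; ring
  rw [h0, sinCosIntegral, sinCosIntegral, ← intervalIntegral.integral_sub
    (intervalIntegrable_sin_rpow_mul hβ (by fun_prop))
    (intervalIntegrable_sin_rpow_mul hβ (by fun_prop)), ← intervalIntegral.integral_neg,
    ← intervalIntegral.integral_mul_const, ← intervalIntegral.integral_div]
  refine intervalIntegral.integral_congr_ae (Eventually.of_forall fun θ hθ => ?_)
  rw [Set.uIoc_of_le Real.pi_pos.le] at hθ
  rcases hθ.2.eq_or_lt with rfl | hlt
  · rw [show -1 * Real.pi + δ = (1 * Real.pi + δ) - 2 * Real.pi by ring, Real.cos_sub_two_pi]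
    simp [Real.zero_rpow (show β + 1 ≠ 0 by linarith)]
  · have hs := Real.sin_pos_of_mem_Ioo ⟨hθ.1, hlt⟩
    rw [Real.rpow_add_one hs.ne', neg_one_mul, neg_add_eq_sub, one_mul, Real.cos_add, Real.cos_sub]
    ring

lemma ofReal_mul_exp_cpow {r φ : ℝ} (hr : 0 < r) (h1 : -Real.pi < φ) (h2 : φ ≤ Real.pi) (α : ℝ) :
    ((r : ℂ) * Complex.exp (φ * Complex.I)) ^ (α : ℂ) =
      ((r ^ α : ℝ) : ℂ) * Complex.exp ((α * φ : ℝ) * Complex.I) := by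
  rw [Complex.cpow_def_of_ne_zero
      (mul_ne_zero (Complex.ofReal_ne_zero.2 hr.ne') (Complex.exp_ne_zero _)),
    Complex.log_ofReal_mul hr (Complex.exp_ne_zero _),
    Complex.log_exp (by simpa using h1) (by simpa using h2), Real.rpow_def_of_pos hr, add_mul,
    Complex.exp_add]
  push_cast
  congr 2
  ring

lemma symbol_eq_of_mem_Ioo {θ : ℝ} (hθ : θ ∈ Set.Ioo 0 Real.pi) (α : ℝ) {σ : ℝ}
    (hσ : σ = 1 ∨ σ = -1) :
    (1 - Complex.exp (((σ * θ : ℝ) : ℂ) * Complex.I)) ^ (α : ℂ) *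
      (1 + Complex.exp (-((σ * θ : ℝ) : ℂ) * Complex.I)) ^ (α : ℂ) =
    (((2 * Real.sin θ) ^ α : ℝ) : ℂ) * Complex.exp ((-σ * (Real.pi * α / 2) : ℝ) * Complex.I) := by
  obtain ⟨h0, hpi⟩ := hθ
  have hs : 0 < Real.sin (θ / 2) := Real.sin_pos_of_pos_of_lt_pi (by linarith) (by linarith)
  have hc : 0 < Real.cos (θ / 2) := Real.cos_pos_of_mem_Ioo ⟨by linarith, by linarith⟩
  have hsin : Real.sin θ = 2 * Real.sin (θ / 2) * Real.cos (θ / 2) := by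
    rw [← Real.sin_two_mul]; congr 1; ring
  have hcos : Real.cos θ = 2 * Real.cos (θ / 2) ^ 2 - 1 := by
    rw [← Real.cos_two_mul]; congr 1; ring
  have hcos' : Real.cos θ = 1 - 2 * Real.sin (θ / 2) ^ 2 := by
    rw [hcos]; nlinarith [Real.sin_sq_add_cos_sq (θ / 2)]
  have e1 : 1 - Complex.exp (((σ * θ : ℝ) : ℂ) * Complex.I) =
      ((2 * Real.sin (θ / 2) : ℝ) : ℂ) *
        Complex.exp (((σ * (θ / 2 - Real.pi / 2) : ℝ) : ℂ) * Complex.I) := by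
    rcases hσ with rfl | rfl <;>
    · apply Complex.ext <;>
      simp [Complex.exp_ofReal_mul_I_re, Complex.exp_ofReal_mul_I_im, -Complex.ofReal_mul,
        -Complex.ofReal_neg, -Complex.ofReal_sub, -Complex.ofReal_div, Real.cos_sub_pi_div_two,
        Real.sin_sub_pi_div_two,
        Real.cos_pi_div_two_sub, Real.sin_pi_div_two_sub] <;> nlinarith
  have e2 : 1 + Complex.exp (-((σ * θ : ℝ) : ℂ) * Complex.I) =
      ((2 * Real.cos (θ / 2) : ℝ) : ℂ) *
        Complex.exp (((-σ * (θ / 2) : ℝ) : ℂ) * Complex.I) := by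
    rw [← Complex.ofReal_neg]
    rcases hσ with rfl | rfl <;>
    · apply Complex.ext <;>
      simp [Complex.exp_ofReal_mul_I_re, Complex.exp_ofReal_mul_I_im, -Complex.ofReal_mul,
        -Complex.ofReal_neg, -Complex.ofReal_sub, -Complex.ofReal_div] <;> nlinarith
  rw [e1, e2, ofReal_mul_exp_cpow (by positivity) (by rcases hσ with rfl | rfl <;> linarith)
      (by rcases hσ with rfl | rfl <;> linarith),
    ofReal_mul_exp_cpow (by positivity) (by rcases hσ with rfl | rfl <;> linarith)
      (by rcases hσ with rfl | rfl <;> linarith), mul_mul_mul_comm, ← Complex.exp_add,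
    ← Complex.ofReal_mul, ← Real.mul_rpow (by positivity) (by positivity), ← add_mul,
    ← Complex.ofReal_add, hsin]
  congr 3
  · ring_nf
  · congr 1
    ring

lemma phiHat_eq_sinCosIntegral {α : ℝ} (hα : -1 < α) (n : ℤ) :
    phiHat α n = ((2 ^ α / Real.pi * sinCosIntegral α (Real.pi * α / 2) n : ℝ) : ℂ) := by
  set F : ℝ → ℂ := fun θ => (1 - Complex.exp ((θ : ℂ) * Complex.I)) ^ (α : ℂ) *
      (1 + Complex.exp (-(θ : ℂ) * Complex.I)) ^ (α : ℂ) *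
      Complex.exp (-(n : ℂ) * (θ : ℂ) * Complex.I) with hF
  have key : ∀ σ : ℝ, (σ = 1 ∨ σ = -1) → ∀ θ ∈ Set.Ioo 0 Real.pi,
      ((2 ^ α * Real.sin θ ^ α : ℝ) : ℂ) *
        Complex.exp ((-σ * (n * θ + Real.pi * α / 2) : ℝ) * Complex.I) = F (σ * θ) := by
    intro σ hσ θ hθ
    rw [hF]
    simp only
    rw [symbol_eq_of_mem_Ioo hθ α hσ, mul_assoc, ← Complex.exp_add,
      Real.mul_rpow zero_le_two (Real.sin_pos_of_mem_Ioo hθ).le]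
    congr 2
    push_cast
    ring
  have hint : ∀ σ : ℝ, (σ = 1 ∨ σ = -1) →
      IntervalIntegrable (fun θ => F (σ * θ)) volume 0 Real.pi := by
    intro σ hσ
    rw [intervalIntegrable_iff_integrableOn_Ioo_of_le Real.pi_pos.le]
    refine IntegrableOn.congr_fun ?_ (key σ hσ) measurableSet_Ioo
    rw [← intervalIntegrable_iff_integrableOn_Ioo_of_le Real.pi_pos.le]
    refine IntervalIntegrable.mul_continuousOn ?_ (by fun_prop)
    rw [intervalIntegrable_iff_integrableOn_Ioo_of_le Real.pi_pos.le]
    exact Integrable.ofReal ((integrableOn_sin_rpow_and_integral_eq hα).1.const_mul _)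
  have hpos : IntervalIntegrable F volume 0 Real.pi := by simpa using hint 1 (Or.inl rfl)
  have hneg : IntervalIntegrable (fun θ => F (-θ)) volume 0 Real.pi := by
    simpa using hint (-1) (Or.inr rfl)
  have hneg' : IntervalIntegrable F volume (-Real.pi) 0 := by
    rw [IntervalIntegrable.iff_comp_neg]
    simpa using hneg.symm
  have h1 : ∫ θ in (-Real.pi)..Real.pi, F θ = ∫ θ in 0..Real.pi, (F θ + F (-θ)) := by
    rw [← intervalIntegral.integral_add_adjacent_intervals hneg' hpos,
      intervalIntegral.integral_add hpos hneg, intervalIntegral.integral_comp_neg, neg_zero,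
      add_comm]
  have h2 : ∫ θ in 0..Real.pi, (F θ + F (-θ)) = ∫ θ in 0..Real.pi,
      ((2 ^ α * 2 * (Real.sin θ ^ α * Real.cos (n * θ + Real.pi * α / 2)) : ℝ) : ℂ) := by
    rw [intervalIntegral.integral_of_le Real.pi_pos.le, integral_Ioc_eq_integral_Ioo,
      intervalIntegral.integral_of_le Real.pi_pos.le, integral_Ioc_eq_integral_Ioo]
    refine setIntegral_congr_fun measurableSet_Ioo fun θ hθ => ?_
    have k1 := key 1 (Or.inl rfl) θ hθ
    have k2 := key (-1) (Or.inr rfl) θ hθ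
    rw [one_mul] at k1
    rw [neg_one_mul] at k2
    rw [← k1, ← k2, ← mul_add]
    push_cast
    have hc := Complex.two_cos ((n : ℂ) * θ + Real.pi * α / 2)
    simp only [neg_neg, one_mul, neg_mul] at hc ⊢
    linear_combination -(((2 ^ α : ℝ) : ℂ) * (Real.sin θ ^ α : ℝ)) * hc
  unfold phiHat
  rw [h1, h2, intervalIntegral.integral_ofReal, intervalIntegral.integral_const_mul,
    sinCosIntegral]
  rw [← Complex.ofReal_ofNat, ← Complex.ofReal_mul, ← Complex.ofReal_one, ← Complex.ofReal_div,
    ← Complex.ofReal_mul, Complex.ofReal_inj]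
  ring

lemma tendsto_of_ratio_recurrence {u : ℕ → ℝ} {s t : ℝ}
    (hs : ∀ m : ℕ, s ≠ -m) (ht : ∀ m : ℕ, t ≠ -m)
    (hu : ∀ m : ℕ, (t + m) * u (m + 1) = (s + m) * u m) :
    Tendsto (fun m : ℕ => u (m + 1) * (m : ℝ) ^ (t - s)) atTop
      (nhds (u 0 * (Real.Gamma t / Real.Gamma s))) := by
  have hs' : ∀ m : ℕ, s + m ≠ 0 := fun m h => hs m (by linarith)
  have ht' : ∀ m : ℕ, t + m ≠ 0 := fun m h => ht m (by linarith)
  have hprod : ∀ m : ℕ, u m * ∏ j ∈ Finset.range m, (t + j) =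
      u 0 * ∏ j ∈ Finset.range m, (s + j) := by
    intro m
    induction m with
    | zero => simp
    | succ m ih =>
      rw [Finset.prod_range_succ, Finset.prod_range_succ, ← mul_assoc (u 0), ← ih]
      linear_combination (∏ j ∈ Finset.range m, (t + j)) * hu m
  have hlim := ((Real.GammaSeq_tendsto_Gamma t).div (Real.GammaSeq_tendsto_Gamma s)
    (Real.Gamma_ne_zero hs)).const_mul (u 0)
  refine hlim.congr' ?_
  filter_upwards [eventually_gt_atTop 0] with m hm
  have hm' : (0 : ℝ) < m := by exact_mod_cast hm
  have p1 : ∏ j ∈ Finset.range (m + 1), (s + j) ≠ 0 := Finset.prod_ne_zero_iff.2 fun j _ => hs' j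
  have p2 : ∏ j ∈ Finset.range (m + 1), (t + j) ≠ 0 := Finset.prod_ne_zero_iff.2 fun j _ => ht' j
  have h := hprod (m + 1)
  have hms : (m : ℝ) ^ s ≠ 0 := by positivity
  have hf : (m.factorial : ℝ) ≠ 0 := by positivity
  simp only [Pi.div_apply, Real.GammaSeq]
  rw [Real.rpow_sub hm', eq_div_of_mul_eq p2 h]
  field_simp

lemma tendsto_of_tendsto_even_odd {X : Type*} {f : ℕ → X} {l : Filter X}
    (h0 : Tendsto (fun m : ℕ => f (2 * m)) atTop l)
    (h1 : Tendsto (fun m : ℕ => f (2 * m + 1)) atTop l) : Tendsto f atTop l := by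
  intro s hs
  obtain ⟨a, ha⟩ := mem_atTop_sets.1 (h0 hs)
  obtain ⟨b, hb⟩ := mem_atTop_sets.1 (h1 hs)
  refine mem_atTop_sets.2 ⟨2 * (a + b), fun n hn => ?_⟩
  rcases Nat.even_or_odd' n with ⟨k, rfl | rfl⟩
  · exact ha k (by omega)
  · exact hb k (by omega)

lemma tendsto_mul_rpow_of_shift {v : ℕ → ℝ} {r : ℕ} {p L : ℝ}
    (h : Tendsto (fun m : ℕ => v (2 * (m + 1) + r) * (m : ℝ) ^ p) atTop (nhds L)) :
    Tendsto (fun m : ℕ => v (2 * m + r) * ((2 * m + r : ℕ) : ℝ) ^ p) atTop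
      (nhds (L * 2 ^ p)) := by
  rw [← tendsto_add_atTop_iff_nat 1]
  have h1 : Tendsto (fun m : ℕ => (2 + (2 + r : ℝ) / m) ^ p) atTop (nhds (2 ^ p)) := by
    have : Tendsto (fun m : ℕ => 2 + (2 + r : ℝ) / m) atTop (nhds (2 + 0)) :=
      (tendsto_const_div_atTop_nhds_zero_nat _).const_add 2
    rw [add_zero] at this
    exact this.rpow_const (Or.inl two_ne_zero)
  refine (h.mul h1).congr' ?_
  filter_upwards [eventually_gt_atTop 0] with m hm
  have hm' : (0 : ℝ) < m := by exact_mod_cast hm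
  rw [mul_assoc, ← Real.mul_rpow hm'.le (by positivity)]
  congr 2
  push_cast
  field_simp
  ring

lemma tendsto_sinCosIntegral_mul_rpow {α : ℝ} (hα : -1 < α) (hnotint : ∀ m : ℤ, α ≠ m) (r : ℕ) :
    Tendsto (fun m : ℕ => sinCosIntegral α (Real.pi * α / 2) ((2 * m + r : ℕ) : ℝ) *
        ((2 * m + r : ℕ) : ℝ) ^ (α + 1)) atTop
      (nhds (sinCosIntegral α (Real.pi * α / 2) r *
        (Real.Gamma ((r + α) / 2 + 1) / Real.Gamma ((r - α) / 2)) * 2 ^ (α + 1))) := by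
  have h := tendsto_of_ratio_recurrence (s := (r - α) / 2) (t := (r + α) / 2 + 1)
    (u := fun m : ℕ => sinCosIntegral α (Real.pi * α / 2) ((2 * m + r : ℕ) : ℝ))
    (fun m hm => hnotint (r + 2 * m) (by push_cast; linarith))
    (fun m hm => by
      have : (0 : ℝ) ≤ r := r.cast_nonneg
      have : (0 : ℝ) ≤ m := m.cast_nonneg
      linarith)
    (fun m => by
      have := sinCosIntegral_add_two hα (Real.pi * α / 2) ((2 * m + r : ℕ) : ℝ)
      rw [show ((2 * (m + 1) + r : ℕ) : ℝ) = ((2 * m + r : ℕ) : ℝ) + 2 by push_cast; ring]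
      push_cast at this ⊢
      linarith)
  rw [show (r + α) / 2 + 1 - (r - α) / 2 = α + 1 by ring] at h
  simp only [mul_zero, zero_add] at h
  exact tendsto_mul_rpow_of_shift
    (v := fun n : ℕ => sinCosIntegral α (Real.pi * α / 2) (n : ℝ)) h

lemma Gamma_ne_zero_of_forall_ne_int {x : ℝ} (hx : ∀ m : ℤ, x ≠ m) : Real.Gamma x ≠ 0 :=
  Real.Gamma_ne_zero fun m h => hx (-m) (by simpa using h)

lemma Gamma_neg_half_mul (α : ℝ) :
    Real.Gamma (-α / 2) * Real.Gamma ((1 - α) / 2) =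
      Real.Gamma (-α) * (2 * 2 ^ α) * √Real.pi := by
  have h := Real.Gamma_mul_Gamma_add_half (-α / 2)
  rw [show -α / 2 + 1 / 2 = (1 - α) / 2 by ring, show 2 * (-α / 2) = -α by ring, sub_neg_eq_add,
    Real.rpow_add two_pos, Real.rpow_one] at h
  exact h

lemma sinCosIntegral_zero_mul {α : ℝ} (hα : -1 < α) (hnotint : ∀ m : ℤ, α ≠ m) :
    2 ^ α / Real.pi * (sinCosIntegral α (Real.pi * α / 2) (0 : ℕ) *
        (Real.Gamma (((0 : ℕ) + α) / 2 + 1) / Real.Gamma (((0 : ℕ) - α) / 2)) * 2 ^ (α + 1)) =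
      2 ^ α / Real.Gamma (-α) := by
  have hW := integral_sin_rpow_mul_Gamma hα
  have hR := Real.Gamma_mul_Gamma_one_sub ((α + 1) / 2)
  rw [show 1 - (α + 1) / 2 = (1 - α) / 2 by ring,
    show Real.pi * ((α + 1) / 2) = Real.pi * α / 2 + Real.pi / 2 by ring,
    Real.sin_add_pi_div_two] at hR
  have hD := Gamma_neg_half_mul α
  have g1 : Real.Gamma (-α) ≠ 0 := Gamma_ne_zero_of_forall_ne_int fun m h =>
    hnotint (-m) (by push_cast; linarith)
  have g2 : Real.Gamma (-α / 2) ≠ 0 := Gamma_ne_zero_of_forall_ne_int fun m h =>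
    hnotint (-(2 * m)) (by push_cast; linarith)
  have g3 : Real.Gamma ((1 - α) / 2) ≠ 0 := Gamma_ne_zero_of_forall_ne_int fun m h =>
    hnotint (1 - 2 * m) (by push_cast; linarith)
  have g4 : Real.Gamma ((α + 1) / 2) ≠ 0 := (Real.Gamma_pos_of_pos (by linarith)).ne'
  have hc : Real.cos (Real.pi * α / 2) ≠ 0 := by
    intro h0
    rw [h0, div_zero] at hR
    exact mul_ne_zero g4 g3 hR
  rw [Nat.cast_zero, sinCosIntegral_zero, zero_add, zero_sub, Real.rpow_add two_pos, Real.rpow_one]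
  have hpi := Real.pi_ne_zero
  rw [eq_div_iff hc] at hR
  rw [eq_div_iff g1]
  calc _ = (2 ^ α / Real.pi * Real.cos (Real.pi * α / 2)) *
        ((∫ θ in 0..Real.pi, Real.sin θ ^ α) * Real.Gamma (α / 2 + 1)) *
        (Real.Gamma (-α) * (2 * 2 ^ α)) / Real.Gamma (-α / 2) := by ring
    _ = (2 ^ α / Real.pi * Real.cos (Real.pi * α / 2)) * Real.Gamma ((α + 1) / 2) *
        (Real.Gamma (-α) * (2 * 2 ^ α) * √Real.pi) / Real.Gamma (-α / 2) := by
          rw [hW]; ring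
    _ = 2 ^ α / Real.pi * (Real.Gamma ((α + 1) / 2) * Real.Gamma ((1 - α) / 2) *
        Real.cos (Real.pi * α / 2)) := by
          rw [← hD, div_eq_iff g2]; ring
    _ = 2 ^ α := by rw [hR]; field_simp

lemma sinCosIntegral_one_mul {α : ℝ} (hα : -1 < α) (hnotint : ∀ m : ℤ, α ≠ m) :
    2 ^ α / Real.pi * (sinCosIntegral α (Real.pi * α / 2) (1 : ℕ) *
        (Real.Gamma (((1 : ℕ) + α) / 2 + 1) / Real.Gamma (((1 : ℕ) - α) / 2)) * 2 ^ (α + 1)) =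
      2 ^ α / Real.Gamma (-α) := by
  have hW := integral_sin_rpow_mul_Gamma (β := α + 1) (by linarith)
  rw [show (α + 1 + 1) / 2 = α / 2 + 1 by ring] at hW
  have hR := Real.Gamma_mul_Gamma_one_sub (α / 2 + 1)
  rw [show 1 - (α / 2 + 1) = -α / 2 by ring,
    show Real.pi * (α / 2 + 1) = Real.pi * α / 2 + Real.pi by ring, Real.sin_add_pi] at hR
  have hD := Gamma_neg_half_mul α
  have g1 : Real.Gamma (-α) ≠ 0 := Gamma_ne_zero_of_forall_ne_int fun m h =>
    hnotint (-m) (by push_cast; linarith)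
  have g2 : Real.Gamma (-α / 2) ≠ 0 := Gamma_ne_zero_of_forall_ne_int fun m h =>
    hnotint (-(2 * m)) (by push_cast; linarith)
  have g3 : Real.Gamma ((1 - α) / 2) ≠ 0 := Gamma_ne_zero_of_forall_ne_int fun m h =>
    hnotint (1 - 2 * m) (by push_cast; linarith)
  have g4 : Real.Gamma (α / 2 + 1) ≠ 0 := (Real.Gamma_pos_of_pos (by linarith)).ne'
  have hs : -Real.sin (Real.pi * α / 2) ≠ 0 := by
    intro h0
    rw [h0, div_zero] at hR
    exact mul_ne_zero g4 g2 hR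
  rw [Nat.cast_one, sinCosIntegral_one hα, Real.rpow_add two_pos, Real.rpow_one, add_comm 1 α]
  have hpi := Real.pi_ne_zero
  rw [eq_div_iff hs] at hR
  rw [eq_div_iff g1]
  calc _ = (2 ^ α / Real.pi * -Real.sin (Real.pi * α / 2)) *
        ((∫ θ in 0..Real.pi, Real.sin θ ^ (α + 1)) * Real.Gamma ((α + 1) / 2 + 1)) *
        (Real.Gamma (-α) * (2 * 2 ^ α)) / Real.Gamma ((1 - α) / 2) := by ring
    _ = (2 ^ α / Real.pi * -Real.sin (Real.pi * α / 2)) * Real.Gamma (α / 2 + 1) *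
        (Real.Gamma (-α) * (2 * 2 ^ α) * √Real.pi) / Real.Gamma ((1 - α) / 2) := by
          rw [hW]; ring
    _ = 2 ^ α / Real.pi * (Real.Gamma (α / 2 + 1) * Real.Gamma (-α / 2) *
        -Real.sin (Real.pi * α / 2)) := by
          rw [← hD]; field_simp
    _ = 2 ^ α := by rw [hR]; field_simp

lemma sinCosIntegral_isLittleO {α : ℝ} (hα : -1 < α) (hnotint : ∀ m : ℤ, α ≠ m) :
    (fun n : ℕ => 2 ^ α / Real.pi * sinCosIntegral α (Real.pi * α / 2) n -
        2 ^ α / Real.Gamma (-α) * (n : ℝ) ^ (-α - 1))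
      =o[atTop] fun n : ℕ => (n : ℝ) ^ (-α - 1) := by
  have hlim : Tendsto (fun n : ℕ => 2 ^ α / Real.pi * (sinCosIntegral α (Real.pi * α / 2) n *
      (n : ℝ) ^ (α + 1))) atTop (nhds (2 ^ α / Real.Gamma (-α))) := by
    apply tendsto_of_tendsto_even_odd
    · have h := (tendsto_sinCosIntegral_mul_rpow hα hnotint 0).const_mul (2 ^ α / Real.pi)
      rwa [sinCosIntegral_zero_mul hα hnotint] at h
    · have h := (tendsto_sinCosIntegral_mul_rpow hα hnotint 1).const_mul (2 ^ α / Real.pi)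
      rwa [sinCosIntegral_one_mul hα hnotint] at h
  have hne : ∀ᶠ n : ℕ in atTop, (n : ℝ) ^ (-α - 1) = 0 →
      2 ^ α / Real.pi * sinCosIntegral α (Real.pi * α / 2) n -
        2 ^ α / Real.Gamma (-α) * (n : ℝ) ^ (-α - 1) = 0 := by
    filter_upwards [eventually_gt_atTop 0] with n hn h
    have hn' : (0 : ℝ) < n := by exact_mod_cast hn
    exact absurd h (Real.rpow_pos_of_pos hn' _).ne'
  rw [isLittleO_iff_tendsto' hne, ← sub_self (2 ^ α / Real.Gamma (-α))]
  refine (hlim.sub_const _).congr' ?_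
  filter_upwards [eventually_gt_atTop 0] with n hn
  have hn' : (0 : ℝ) < n := by exact_mod_cast hn
  have hp : (n : ℝ) ^ (α + 1) ≠ 0 := by positivity
  rw [show -α - 1 = -(α + 1) by ring, Real.rpow_neg hn'.le]
  field_simp

/-- As `n → ∞`, `φ̂_α(n) = c_α n^{-α-1} + o(n^{-α-1})` and
`φ̂_α(-n) = (-1)^n c_α n^{-α-1} + o(n^{-α-1})`, where `c_α = 2^α / Γ(-α)`. -/
theorem phiHat_asymptotics (α : ℝ) (hα : -(1 / 2 : ℝ) < α) (hnotint : ∀ m : ℤ, α ≠ m) :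
    ((fun n : ℕ => phiHat α n -
        (((2 : ℝ) ^ α / Real.Gamma (-α) * (n : ℝ) ^ (-α - 1) : ℝ) : ℂ))
      =o[atTop] fun n : ℕ => (n : ℝ) ^ (-α - 1)) ∧
    ((fun n : ℕ => phiHat α (-(n : ℤ)) -
        ((-1 : ℂ) ^ n * (((2 : ℝ) ^ α / Real.Gamma (-α) * (n : ℝ) ^ (-α - 1) : ℝ) : ℂ)))
      =o[atTop] fun n : ℕ => (n : ℝ) ^ (-α - 1)) := by
  have hα' : -1 < α := by linarith
  have h := sinCosIntegral_isLittleO hα' hnotint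
  constructor <;> refine IsLittleO.of_norm_left (h.norm_left.congr_left fun n => ?_)
  · rw [phiHat_eq_sinCosIntegral hα', ← Complex.ofReal_sub, Complex.norm_real, Int.cast_natCast]
  · rw [phiHat_eq_sinCosIntegral hα', Int.cast_neg, Int.cast_natCast, sinCosIntegral_neg_natCast,
      mul_left_comm, Complex.ofReal_mul, Complex.ofReal_pow, Complex.ofReal_neg,
      Complex.ofReal_one, ← mul_sub, ← Complex.ofReal_sub, norm_mul, Complex.norm_real, norm_pow]
    simp
end

section
/- Let α ∈ (0,1) and let f : (0,1) → ℝ be locally Lipschitz on (0,1) and belong to the class L¹_{1−α}((0,1)). Then for every x ∈ (0,1) the limit lim_{N→∞} N^α Σ_{l=0}^{N} φ̂_α(⌊Nx⌋ − l) · X_{N,l} exists and equals (2^α/Γ(−α)) · ( ∫₀^x (x−t)^{−α−1} (f(t) − f(x)) dt − f(x) · x^{−α}/α ). -/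
open MeasureTheory Filter Asymptotics

/-- The discretization vector `X_{N,l}`: `f(l/N)` for `0 < l < N`, and `0` at the endpoints. -/
noncomputable def Xvec (f : ℝ → ℝ) (N l : ℕ) : ℝ :=
  if l = 0 ∨ l = N then 0 else f ((l : ℝ) / (N : ℝ))

/-- `f` is locally Lipschitz (locally contracting) on `(0,1)`. -/
def LocLip01 (f : ℝ → ℝ) : Prop :=
  ∀ a b : ℝ, 0 < a → a ≤ b → b < 1 →
    ∃ K : ℝ, ∀ z ∈ Set.Icc a b, ∀ z' ∈ Set.Icc a b, |f z - f z'| ≤ K * |z - z'|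

/-- `f` belongs to the class `L¹_{1-α}((0,1))`: for some `γ ∈ [0, 1-α]`,
`f(t) = O(t^{-γ})` and `f(1-t) = O(t^{-γ})` as `t → 0⁺`. -/
def MemL1Class (α : ℝ) (f : ℝ → ℝ) : Prop :=
  ∃ γ : ℝ, 0 ≤ γ ∧ γ ≤ 1 - α ∧
    (f =O[nhdsWithin 0 (Set.Ioi 0)] fun t : ℝ => t ^ (-γ)) ∧
    ((fun t : ℝ => f (1 - t)) =O[nhdsWithin 0 (Set.Ioi 0)] fun t : ℝ => t ^ (-γ))

/-- The `k`-th Taylor coefficient at `0` of `z ↦ (1 - z) ^ α`. -/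
noncomputable def oneSubCoeff (α : ℝ) (k : ℕ) : ℝ :=
  ∏ j ∈ Finset.range k, (((j : ℝ) - α) / ((j : ℝ) + 1))

lemma oneSubCoeff_eq_choose (α : ℝ) (k : ℕ) :
    oneSubCoeff α k = (-1) ^ k * Ring.choose α k := by
  induction k with
  | zero => simp [oneSubCoeff]
  | succ k ih =>
    have h1 := Ring.descPochhammer_eq_factorial_smul_choose α k
    have h2 := Ring.descPochhammer_eq_factorial_smul_choose α (k + 1)
    rw [descPochhammer_succ_right, Polynomial.smeval_mul, h1] at h2
    simp only [Polynomial.smeval_sub, Polynomial.smeval_X, pow_one, Polynomial.smeval_natCast,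
      pow_zero, nsmul_eq_mul, mul_one, Nat.factorial_succ, Nat.cast_mul] at h2
    have hk : (Nat.factorial k : ℝ) ≠ 0 := by exact_mod_cast Nat.factorial_ne_zero k
    have h3 : Ring.choose α k * (α - k) = ((k : ℝ) + 1) * Ring.choose α (k + 1) := by
      apply mul_left_cancel₀ hk
      push_cast at h2
      linarith
    have hk1 : (k : ℝ) + 1 ≠ 0 := by positivity
    rw [oneSubCoeff, Finset.prod_range_succ, ← oneSubCoeff, ih]
    field_simp
    rw [pow_succ]
    linear_combination (-1) ^ k * (-h3)

lemma tendsto_rpow_mul_oneSubCoeff (α : ℝ) :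
    Tendsto (fun n : ℕ => ((n : ℝ) + 1) ^ (α + 1) * oneSubCoeff α (n + 1)) atTop
      (nhds (Real.Gamma (-α))⁻¹) := by
  by_cases h0 : ∃ m : ℕ, α = m
  · obtain ⟨m, rfl⟩ := h0
    rw [Real.Gamma_neg_nat_eq_zero, inv_zero]
    refine tendsto_const_nhds.congr' ?_
    filter_upwards [eventually_ge_atTop m] with n hn
    rw [oneSubCoeff, Finset.prod_eq_zero (i := m) (by simpa using Nat.lt_succ_of_le hn) (by simp)]
    simp
  push Not at h0
  have hΓ : Real.Gamma (-α) ≠ 0 := Real.Gamma_ne_zero fun m h => h0 m (by linarith)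
  have h1 := (Real.GammaSeq_tendsto_Gamma (-α)).inv₀ hΓ
  have h2 : Tendsto (fun n : ℕ => (1 + 1 / (n : ℝ)) ^ α) atTop (nhds 1) := by
    have : Tendsto (fun n : ℕ => 1 + 1 / (n : ℝ)) atTop (nhds (1 + 0)) :=
      tendsto_const_nhds.add tendsto_one_div_atTop_nhds_zero_nat
    simpa using this.rpow_const (p := α) (by simp)
  have h3 := h2.mul h1
  rw [one_mul] at h3
  refine h3.congr' ?_
  filter_upwards [eventually_gt_atTop 0] with n hn
  have hn' : (0 : ℝ) < n := by exact_mod_cast hn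
  have e1 : (1 + 1 / (n : ℝ)) = (n + 1) / n := by field_simp
  have e2 : oneSubCoeff α (n + 1) =
      (∏ j ∈ Finset.range (n + 1), (-α + (j : ℝ))) / ((n + 1) * (Nat.factorial n : ℝ)) := by
    rw [oneSubCoeff, Finset.prod_div_distrib]
    congr 1
    · exact Finset.prod_congr rfl fun _ _ => by ring
    · have := Finset.prod_range_add_one_eq_factorial (n + 1)
      rw [Nat.factorial_succ] at this
      exact_mod_cast this
  have hf : (Nat.factorial n : ℝ) ≠ 0 := by exact_mod_cast Nat.factorial_ne_zero n
  rw [e1, e2, Real.GammaSeq, Real.div_rpow (by positivity) hn'.le, Real.rpow_neg hn'.le,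
    Real.rpow_add_one (by positivity)]
  have : (n : ℝ) ^ α ≠ 0 := (Real.rpow_pos_of_pos hn' _).ne'
  have hn1 : (n : ℝ) + 1 ≠ 0 := by positivity
  field_simp

lemma exists_abs_le_of_tendsto_rpow_mul {s κ : ℝ} {p : ℕ → ℝ}
    (hp : Tendsto (fun n : ℕ => ((n : ℝ) + 1) ^ s * p n) atTop (nhds κ)) :
    ∃ C, 0 ≤ C ∧ ∀ n : ℕ, |p n| ≤ C * ((n : ℝ) + 1) ^ (-s) := by
  obtain ⟨C, hC⟩ := (Metric.isBounded_range_of_tendsto _ hp).exists_norm_le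
  refine ⟨C, (norm_nonneg _).trans (hC _ ⟨0, rfl⟩), fun n => ?_⟩
  have hn : (0 : ℝ) < (n : ℝ) + 1 := by positivity
  have h := hC _ ⟨n, rfl⟩
  have hpos := Real.rpow_pos_of_pos hn s
  simp only [Real.norm_eq_abs, abs_mul, abs_of_pos hpos] at h
  rw [Real.rpow_neg hn.le, ← div_eq_mul_inv, le_div_iff₀ hpos]
  linarith

lemma summable_rpow_neg_add_one {s : ℝ} (hs : 1 < s) :
    Summable fun n : ℕ => ((n : ℝ) + 1) ^ (-s) := by
  have := (summable_nat_add_iff 1).2 (Real.summable_nat_rpow.2 (neg_lt_neg hs))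
  simpa using this

lemma summable_abs_oneSubCoeff {α : ℝ} (hα : 0 < α) :
    Summable fun k => |oneSubCoeff α k| := by
  obtain ⟨C, -, hC⟩ := exists_abs_le_of_tendsto_rpow_mul (tendsto_rpow_mul_oneSubCoeff α)
  rw [← summable_nat_add_iff 1]
  exact Summable.of_nonneg_of_le (fun _ => abs_nonneg _) hC
    ((summable_rpow_neg_add_one (by linarith)).mul_left C)

lemma tsum_oneSubCoeff_mul_pow {α : ℝ} (hα : 0 < α) {z : ℂ} (hz : ‖z‖ ≤ 1) :
    ∑' k, (oneSubCoeff α k : ℂ) * z ^ k = (1 - z) ^ (α : ℂ) := by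
  have hball : Set.EqOn (fun z : ℂ => ∑' k, (oneSubCoeff α k : ℂ) * z ^ k)
      (fun z => (1 - z) ^ (α : ℂ)) (Metric.ball 0 1) := by
    intro w hw
    have hw' : -w ∈ Metric.eball (0 : ℂ) 1 := by
      rw [← ENNReal.ofReal_one, Metric.eball_ofReal]
      simpa using hw
    have h := (Complex.one_add_cpow_hasFPowerSeriesOnBall_zero (a := (α : ℂ))).hasSum hw'
    simp only [binomialSeries_apply, zero_add] at h
    rw [← sub_eq_add_neg] at h
    refine Eq.trans (tsum_congr fun k => ?_) h.tsum_eq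
    simp [oneSubCoeff_eq_choose, neg_pow w, Complex.ofReal_choose, List.ofFn_const]
    ring
  have hcont1 : ContinuousOn (fun z : ℂ => ∑' k, (oneSubCoeff α k : ℂ) * z ^ k)
      (Metric.closedBall 0 1) := by
    refine continuousOn_tsum (fun k => by fun_prop) (summable_abs_oneSubCoeff hα) ?_
    intro k w hw
    have hw' : ‖w‖ ≤ 1 := by simpa using hw
    rw [norm_mul, norm_pow, Complex.norm_real, Real.norm_eq_abs]
    exact mul_le_of_le_one_right (abs_nonneg _) (pow_le_one₀ (norm_nonneg _) hw')
  have hcont2 : ContinuousOn (fun z : ℂ => (1 - z) ^ (α : ℂ)) (Metric.closedBall 0 1) := by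
    intro w hw
    have hw' : ‖w‖ ≤ 1 := by simpa using hw
    have hre : 0 ≤ (1 - w).re := by
      have := (Complex.re_le_norm w).trans hw'
      simpa using this
    have := (Complex.continuousAt_cpow_const_of_re_pos (z := 1 - w) (w := (α : ℂ)) (Or.inl hre)
      (by simpa using hα)).comp (f := fun z : ℂ => 1 - z) (x := w) (by fun_prop)
    exact this.continuousWithinAt
  have := hball.of_subset_closure hcont1 hcont2 Metric.ball_subset_closedBall
    (by rw [closure_ball _ one_ne_zero])
  exact this (by simpa using hz)

/-- The coefficient of `e^{i(k-j)θ}`, for `q = (k, j)`, in the product of the Taylor series of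
`(1-e^{iθ})^α` and `(1+e^{-iθ})^α`. -/
noncomputable def symbolTerm (α : ℝ) (q : ℕ × ℕ) : ℝ :=
  oneSubCoeff α q.1 * ((-1) ^ q.2 * oneSubCoeff α q.2)

/-- The real value of the Fourier coefficient `phiHat α n`. -/
noncomputable def realPhiHat (α : ℝ) (n : ℤ) : ℝ :=
  ∑' q : ℕ × ℕ, ((fun q : ℕ × ℕ => (q.1 : ℤ) - q.2) ⁻¹' {n}).indicator (symbolTerm α) q

lemma summable_norm_neg_one_pow_mul_oneSubCoeff {α : ℝ} (hα : 0 < α) :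
    Summable fun k => ‖(-1) ^ k * oneSubCoeff α k‖ := by
  simpa [abs_mul] using summable_abs_oneSubCoeff hα

lemma summable_norm_symbolTerm {α : ℝ} (hα : 0 < α) : Summable fun q => ‖symbolTerm α q‖ :=
  Summable.mul_norm (f := oneSubCoeff α) (g := fun k => (-1) ^ k * oneSubCoeff α k)
    (summable_abs_oneSubCoeff hα) (summable_norm_neg_one_pow_mul_oneSubCoeff hα)

lemma tsum_oneSubCoeff {α : ℝ} (hα : 0 < α) : ∑' k, oneSubCoeff α k = 0 := by
  have h := tsum_oneSubCoeff_mul_pow hα (z := 1) (by simp)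
  rw [sub_self, Complex.zero_cpow (by exact_mod_cast hα.ne')] at h
  simp only [one_pow, mul_one] at h
  exact_mod_cast h

lemma tsum_neg_one_pow_mul_oneSubCoeff {α : ℝ} (hα : 0 < α) :
    ∑' k, (-1) ^ k * oneSubCoeff α k = 2 ^ α := by
  have h := tsum_oneSubCoeff_mul_pow hα (z := -1) (by simp)
  have e : ((1 : ℂ) - -1) ^ (α : ℂ) = ((2 ^ α : ℝ) : ℂ) := by
    rw [Complex.ofReal_cpow zero_le_two]; norm_num
  rw [e] at h
  have : ∑' k, (((-1) ^ k * oneSubCoeff α k : ℝ) : ℂ) = ((2 ^ α : ℝ) : ℂ) := by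
    rw [← h]
    exact tsum_congr fun k => by push_cast; ring
  exact_mod_cast this

lemma hasSum_realPhiHat {α : ℝ} (hα : 0 < α) : HasSum (realPhiHat α) 0 := by
  have hs : HasSum (symbolTerm α) 0 := by
    have h := tsum_mul_tsum_of_summable_norm (f := oneSubCoeff α)
      (g := fun k => (-1) ^ k * oneSubCoeff α k)
      (summable_abs_oneSubCoeff hα) (summable_norm_neg_one_pow_mul_oneSubCoeff hα)
    rw [tsum_oneSubCoeff hα, zero_mul] at h
    rw [h]
    exact (summable_norm_symbolTerm hα).of_norm.hasSum
  have h := hs.tsum_fiberwise fun q : ℕ × ℕ => (q.1 : ℤ) - q.2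
  have e : realPhiHat α = fun n : ℤ =>
      ∑' q : ((fun q : ℕ × ℕ => (q.1 : ℤ) - q.2) ⁻¹' {n}), symbolTerm α q :=
    funext fun n => (tsum_subtype _ _).symm
  rw [e]
  exact h

lemma realPhiHat_natCast (α : ℝ) (n : ℕ) :
    realPhiHat α n = ∑' j, oneSubCoeff α (n + j) * ((-1) ^ j * oneSubCoeff α j) := by
  have hinj : Function.Injective fun j : ℕ => ((n + j, j) : ℕ × ℕ) := fun a b h =>
    (Prod.ext_iff.1 h).2
  rw [realPhiHat, ← hinj.tsum_eq]
  · exact tsum_congr fun j => by simp [symbolTerm]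
  · intro q hq
    have := Set.mem_of_indicator_ne_zero hq
    simp only [Set.mem_preimage, Set.mem_singleton_iff] at this
    exact ⟨q.2, Prod.ext (by simp; omega) rfl⟩

lemma realPhiHat_neg_natCast (α : ℝ) (n : ℕ) :
    realPhiHat α (-n) = (-1) ^ n * realPhiHat α n := by
  have hinj : Function.Injective fun j : ℕ => ((j, n + j) : ℕ × ℕ) := fun a b h =>
    (Prod.ext_iff.1 h).1
  rw [realPhiHat_natCast, realPhiHat, ← hinj.tsum_eq, ← tsum_mul_left]
  · refine tsum_congr fun j => ?_
    simp [symbolTerm, pow_add]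
    ring
  · intro q hq
    have := Set.mem_of_indicator_ne_zero hq
    simp only [Set.mem_preimage, Set.mem_singleton_iff] at this
    exact ⟨q.1, Prod.ext rfl (by simp; omega)⟩

lemma tendsto_rpow_mul_realPhiHat {α : ℝ} (hα : 0 < α) :
    Tendsto (fun n : ℕ => ((n : ℝ) + 1) ^ (α + 1) * realPhiHat α ((n + 1 : ℕ) : ℤ)) atTop
      (nhds (2 ^ α / Real.Gamma (-α))) := by
  have hc := tendsto_rpow_mul_oneSubCoeff α
  obtain ⟨C, hC0, hC⟩ := exists_abs_le_of_tendsto_rpow_mul hc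
  have hlim : ∑' j, (Real.Gamma (-α))⁻¹ * ((-1) ^ j * oneSubCoeff α j) =
      2 ^ α / Real.Gamma (-α) := by
    rw [tsum_mul_left, tsum_neg_one_pow_mul_oneSubCoeff hα]; ring
  simp only [realPhiHat_natCast, ← tsum_mul_left]
  rw [← hlim]
  refine tendsto_tsum_of_dominated_convergence
    ((summable_norm_neg_one_pow_mul_oneSubCoeff hα).mul_left C) (fun j => ?_)
    (Eventually.of_forall fun n j => ?_)
  · simp only [← mul_assoc]
    refine (Tendsto.mul_const _ ?_).mul_const _
    have h1 : Tendsto (fun n : ℕ => ((n : ℝ) + 1) / (n + 1 + j)) atTop (nhds 1) := by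
      have h2 : Tendsto (fun n : ℕ => (((n : ℝ) + 1 + j) / (n + 1))) atTop (nhds (1 + 0)) := by
        have h3 : Tendsto (fun n : ℕ => (j : ℝ) * (1 / ((n : ℝ) + 1))) atTop (nhds (j * 0)) :=
          tendsto_one_div_add_atTop_nhds_zero_nat.const_mul _
        rw [mul_zero] at h3
        refine (tendsto_const_nhds.add h3).congr fun n => ?_
        field_simp
      have := h2.inv₀ (by norm_num)
      simpa using this
    have h4 := (h1.rpow_const (p := α + 1) (by simp)).mul
      (hc.comp (tendsto_add_atTop_nat j))
    rw [Real.one_rpow, one_mul] at h4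
    refine h4.congr fun n => ?_
    have hp : (0 : ℝ) < (n : ℝ) + 1 + j := by positivity
    have := (Real.rpow_pos_of_pos hp (α + 1)).ne'
    simp only [Function.comp_apply]
    rw [Real.div_rpow (by positivity) hp.le, show n + j + 1 = n + 1 + j by ring]
    push_cast
    rw [show (n : ℝ) + j + 1 = n + 1 + j by ring]
    field_simp
  · rw [← mul_assoc, norm_mul]
    refine mul_le_mul_of_nonneg_right ?_ (norm_nonneg _)
    have hn : (0 : ℝ) < (n : ℝ) + 1 := by positivity
    have hpos := Real.rpow_pos_of_pos hn (α + 1)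
    rw [norm_mul, Real.norm_of_nonneg hpos.le, Real.norm_eq_abs,
      show n + 1 + j = n + j + 1 by ring]
    calc _ ≤ ((n : ℝ) + 1) ^ (α + 1) * (C * (((n + j : ℕ) : ℝ) + 1) ^ (-(α + 1))) := by
          gcongr; exact hC _
      _ ≤ ((n : ℝ) + 1) ^ (α + 1) * (C * ((n : ℝ) + 1) ^ (-(α + 1))) := by
          gcongr ?_ * (C * ?_)
          exact Real.rpow_le_rpow_of_nonpos hn (by push_cast; linarith [Nat.cast_nonneg (α := ℝ) j])
            (by linarith)
      _ = C := by
          rw [Real.rpow_neg hn.le]; field_simp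

lemma integral_exp_int_mul_I (n : ℤ) :
    ∫ θ in (-Real.pi)..Real.pi, Complex.exp ((n : ℂ) * θ * Complex.I) =
      if n = 0 then 2 * (Real.pi : ℂ) else 0 := by
  split_ifs with h
  · simp [h]; ring
  · have hc : (n : ℂ) * Complex.I ≠ 0 := mul_ne_zero (by exact_mod_cast h) Complex.I_ne_zero
    have h1 := integral_exp_mul_complex (a := -Real.pi) (b := Real.pi) hc
    rw [show (fun θ : ℝ => Complex.exp ((n : ℂ) * θ * Complex.I)) =
      fun θ : ℝ => Complex.exp ((n : ℂ) * Complex.I * θ) from by ext; ring_nf, h1]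
    rw [div_eq_zero_iff]
    left
    rw [sub_eq_zero, Complex.exp_eq_exp_iff_exists_int]
    exact ⟨n, by push_cast; ring⟩

lemma phiHat_eq_realPhiHat {α : ℝ} (hα : 0 < α) (n : ℤ) : phiHat α n = realPhiHat α n := by
  have hsum := summable_norm_symbolTerm hα
  have key : HasSum (fun q : ℕ × ℕ => ∫ θ in (-Real.pi)..Real.pi,
      (symbolTerm α q : ℂ) * Complex.exp ((((q.1 : ℤ) - q.2 - n : ℤ) : ℂ) * θ * Complex.I))
      (∫ θ in (-Real.pi)..Real.pi,
        (1 - Complex.exp ((θ : ℂ) * Complex.I)) ^ (α : ℂ) *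
        (1 + Complex.exp (-(θ : ℂ) * Complex.I)) ^ (α : ℂ) *
        Complex.exp (-(n : ℂ) * (θ : ℂ) * Complex.I)) := by
    refine intervalIntegral.hasSum_integral_of_dominated_convergence
      (fun q _ => ‖symbolTerm α q‖) (fun q => ?_) (fun q => ?_) ?_ ?_ ?_
    · exact (by fun_prop : Continuous _).aestronglyMeasurable
    · refine Eventually.of_forall fun θ _ => le_of_eq ?_
      rw [norm_mul, Complex.norm_real, ← Complex.ofReal_intCast, ← Complex.ofReal_mul,
        Complex.norm_exp_ofReal_mul_I, mul_one]
    · exact Eventually.of_forall fun θ _ => hsum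
    · exact intervalIntegrable_const
    · refine Eventually.of_forall fun θ _ => ?_
      have n1 : ‖Complex.exp ((θ : ℂ) * Complex.I)‖ = 1 := Complex.norm_exp_ofReal_mul_I θ
      have n2 : ‖-Complex.exp (-(θ : ℂ) * Complex.I)‖ = 1 := by
        rw [norm_neg]; exact_mod_cast Complex.norm_exp_ofReal_mul_I (-θ)
      have s1 : Summable fun k =>
          ‖(oneSubCoeff α k : ℂ) * Complex.exp ((θ : ℂ) * Complex.I) ^ k‖ := by
        simpa [n1] using summable_abs_oneSubCoeff hα
      have s2 : Summable fun k =>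
          ‖(oneSubCoeff α k : ℂ) * (-Complex.exp (-(θ : ℂ) * Complex.I)) ^ k‖ := by
        simp only [norm_mul, norm_pow, n2]
        simpa using summable_abs_oneSubCoeff hα
      have h := (summable_mul_of_summable_norm s1 s2).hasSum
      rw [← tsum_mul_tsum_of_summable_norm s1 s2, tsum_oneSubCoeff_mul_pow hα n1.le,
        tsum_oneSubCoeff_mul_pow hα n2.le, sub_neg_eq_add] at h
      refine (congrArg (HasSum · _) (funext fun q => ?_)).mp (h.mul_right _)
      have hexp : Complex.exp ((((q.1 : ℤ) - q.2 - n : ℤ) : ℂ) * θ * Complex.I) =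
          Complex.exp ((θ : ℂ) * Complex.I) ^ q.1 *
          Complex.exp (-(θ : ℂ) * Complex.I) ^ q.2 *
          Complex.exp (-(n : ℂ) * (θ : ℂ) * Complex.I) := by
        rw [← Complex.exp_nat_mul, ← Complex.exp_nat_mul, ← Complex.exp_add, ← Complex.exp_add]
        congr 1
        push_cast
        ring
      rw [hexp, symbolTerm, neg_pow (Complex.exp _)]
      push_cast
      ring
  have h2 : HasSum (fun q : ℕ × ℕ => ((((fun q : ℕ × ℕ => (q.1 : ℤ) - q.2) ⁻¹' {n}).indicator
      (symbolTerm α) q : ℝ) : ℂ)) (realPhiHat α n) :=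
    Complex.hasSum_ofReal.2 (hsum.of_norm.indicator _).hasSum
  have h3 := key.mul_left (1 / (2 * (Real.pi : ℂ)))
  refine h3.unique ((congrArg (HasSum · _) (funext fun q => ?_)).mp h2)
  rw [intervalIntegral.integral_const_mul, integral_exp_int_mul_I]
  have hpi : (Real.pi : ℂ) ≠ 0 := by exact_mod_cast Real.pi_ne_zero
  by_cases hq : (q.1 : ℤ) - q.2 = n
  · rw [if_pos (by omega), Set.indicator_of_mem (by simpa using hq)]
    field_simp
  · rw [if_neg (by omega), Set.indicator_of_notMem (by simpa using hq)]
    simp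

lemma integral_comp_natFloor_mul {a : ℝ} (ha : 0 < a) (g : ℕ → ℝ) (M : ℕ) :
    ∫ u in (0 : ℝ)..(M / a), g ⌊a * u⌋₊ = a⁻¹ * ∑ i ∈ Finset.range M, g i := by
  have key : ∀ i : ℕ, Set.EqOn (fun u : ℝ => g ⌊u⌋₊) (fun _ => g i)
      (Set.Ioo (i : ℝ) ((i + 1 : ℕ) : ℝ)) := by
    intro i u hu
    have : ⌊u⌋₊ = i := by
      rw [Nat.floor_eq_iff ((Nat.cast_nonneg i).trans hu.1.le)]
      exact ⟨hu.1.le, by exact_mod_cast hu.2⟩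
    simp only [this]
  have hint : ∀ i : ℕ, IntervalIntegrable (fun u : ℝ => g ⌊u⌋₊) volume i ((i + 1 : ℕ) : ℝ) := by
    intro i
    refine (intervalIntegrable_const (c := g i)).congr_uIoo ?_
    rw [Set.uIoo_of_le (by push_cast; linarith)]
    exact (key i).symm
  rw [intervalIntegral.integral_comp_mul_left (fun u => g ⌊u⌋₊) ha.ne', mul_zero,
    mul_div_cancel₀ _ ha.ne', smul_eq_mul]
  congr 1
  have h := intervalIntegral.sum_integral_adjacent_intervals (a := fun i : ℕ => (i : ℝ)) (n := M)
    fun i _ => hint i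
  rw [Nat.cast_zero] at h
  rw [← h]
  refine Finset.sum_congr rfl fun i _ => ?_
  have hle : (i : ℝ) ≤ ((i + 1 : ℕ) : ℝ) := by push_cast; linarith
  rw [intervalIntegral.integral_of_le hle, integral_Ioc_eq_integral_Ioo,
    setIntegral_congr_fun measurableSet_Ioo (key i), ← integral_Ioc_eq_integral_Ioo,
    ← intervalIntegral.integral_of_le hle]
  simp

lemma integral_Ioi_comp_natFloor_mul {a : ℝ} (ha : 0 < a) {g : ℕ → ℝ} (hg : Summable g)
    (hi : IntegrableOn (fun u : ℝ => g ⌊a * u⌋₊) (Set.Ioi 0)) :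
    ∫ u in Set.Ioi (0 : ℝ), g ⌊a * u⌋₊ = a⁻¹ * ∑' i, g i := by
  have h1 := intervalIntegral_tendsto_integral_Ioi 0 hi
    (tendsto_natCast_atTop_atTop.atTop_div_const ha)
  simp only [integral_comp_natFloor_mul ha] at h1
  exact tendsto_nhds_unique h1 (hg.hasSum.tendsto_sum_nat.const_mul _)

lemma integrableOn_rpow_neg_mul_abs_sub_rpow_neg {α γ y T : ℝ} (hα0 : 0 ≤ α) (hα : α < 1)
    (hγ0 : 0 ≤ γ) (hγ : γ < 1) (hy : 0 < y) (hT : y ≤ T) :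
    IntegrableOn (fun u : ℝ => u ^ (-α) * |y - u| ^ (-γ)) (Set.Ioc 0 T) := by
  have i1 : IntegrableOn (fun u : ℝ => u ^ (-α)) (Set.Ioc 0 T) :=
    (intervalIntegral.intervalIntegrable_rpow' (a := 0) (b := T) (by linarith)).1
  have i2 : IntegrableOn (fun u : ℝ => |y - u| ^ (-γ)) (Set.Ioc 0 T) := by
    rw [← Set.Ioc_union_Ioc_eq_Ioc hy.le hT]
    refine IntegrableOn.union ?_ ?_
    · have h := ((intervalIntegral.intervalIntegrable_rpow' (a := y) (b := 0)
        (by linarith : -1 < -γ)).comp_sub_left y).1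
      rw [sub_self, sub_zero] at h
      refine h.congr_fun (fun u hu => ?_) measurableSet_Ioc
      simp only [abs_of_nonneg (sub_nonneg.2 hu.2)]
    · have h := ((intervalIntegral.intervalIntegrable_rpow' (a := 0) (b := T - y)
        (by linarith : -1 < -γ)).comp_sub_right y).1
      rw [zero_add, sub_add_cancel] at h
      refine h.congr_fun (fun u hu => ?_) measurableSet_Ioc
      simp only [abs_sub_comm y u, abs_of_nonneg (sub_nonneg.2 hu.1.le)]
  refine Integrable.mono' ((i1.const_mul ((y / 2) ^ (-γ))).add (i2.const_mul ((y / 2) ^ (-α))))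
    (by fun_prop) ?_
  refine (ae_restrict_iff' measurableSet_Ioc).2 (Eventually.of_forall fun u hu => ?_)
  have hu0 : 0 < u := hu.1
  have p1 := Real.rpow_nonneg hu0.le (-α)
  have p2 := Real.rpow_nonneg (abs_nonneg (y - u)) (-γ)
  have p3 := Real.rpow_nonneg (half_pos hy).le (-γ)
  have p4 := Real.rpow_nonneg (half_pos hy).le (-α)
  rw [Real.norm_of_nonneg (mul_nonneg p1 p2)]
  simp only [Pi.add_apply]
  rcases le_total u (y / 2) with hle | hle
  · have : |y - u| ^ (-γ) ≤ (y / 2) ^ (-γ) :=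
      Real.rpow_le_rpow_of_nonpos (half_pos hy)
        (le_trans (by linarith) (le_abs_self _)) (by linarith)
    nlinarith [mul_nonneg p4 p2, mul_le_mul_of_nonneg_left this p1]
  · have : u ^ (-α) ≤ (y / 2) ^ (-α) :=
      Real.rpow_le_rpow_of_nonpos (half_pos hy) hle (by linarith)
    nlinarith [mul_nonneg p3 p1, mul_le_mul_of_nonneg_right this p2]

/-- An integrable function dominating the step functions whose integrals are the sums in
`tendsto_rpow_mul_tsum`. -/
noncomputable def stepBound (α γ y K : ℝ) (u : ℝ) : ℝ :=
  (Set.Ioc 0 (y + 1)).indicator (fun u => 2 * K * (5⁻¹ : ℝ) ^ (-γ) * (u ^ (-α) * |y - u| ^ (-γ))) u +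
    K * (2⁻¹ : ℝ) ^ (-(α + 1)) * (u + y / 2) ^ (-(α + 1))

lemma integrableOn_stepBound {α γ y : ℝ} (hα0 : 0 < α) (hα : α < 1)
    (hγ0 : 0 ≤ γ) (hγ : γ < 1) (hy : 0 < y) (K : ℝ) :
    IntegrableOn (stepBound α γ y K) (Set.Ioi 0) := by
  refine Integrable.add ?_ ?_
  · rw [integrable_indicator_iff measurableSet_Ioc]
    have h := (integrableOn_rpow_neg_mul_abs_sub_rpow_neg hα0.le hα hγ0 hγ hy
      (by linarith : y ≤ y + 1)).const_mul (2 * K * (5⁻¹ : ℝ) ^ (-γ))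
    rw [IntegrableOn, Measure.restrict_restrict measurableSet_Ioc,
      Set.inter_eq_left.2 Set.Ioc_subset_Ioi_self]
    exact h
  · exact (integrableOn_add_rpow_Ioi_of_lt (by linarith) (by linarith)).const_mul _

lemma norm_step_le_stepBound {α γ y L C a τ u P : ℝ} {h : ℝ → ℝ} {i : ℕ} (hα0 : 0 < α)
    (hγ0 : 0 ≤ γ) (hy : 0 < y) (hC : 0 ≤ C)
    (hb1 : ∀ v, 0 < v → v < y → |h v| ≤ L * (v * (y - v) ^ (-γ)))
    (hb2 : ∀ v, y ≤ v → |h v| ≤ L) (ha : 1 ≤ a) (hτ : |τ| < 1) (hu : 0 < u) (huy : u ≠ y)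
    (hi1 : (i : ℝ) ≤ a * u) (hi2 : a * u < i + 1) (hP : |P| ≤ C * ((i : ℝ) + 1) ^ (-(α + 1)))
    (hgap : (i : ℝ) + 1 + τ < a * y → (i : ℝ) + 1 + τ + 1 / 2 ≤ a * y) :
    ‖a ^ (α + 1) * (P * h ((i + 1 + τ) / a))‖ ≤ stepBound α γ y (C * L) u := by
  have hL : 0 ≤ L := (abs_nonneg _).trans (hb2 y le_rfl)
  have ha0 : 0 < a := by linarith
  obtain ⟨hτ1, hτ2⟩ := abs_lt.1 hτ
  have hi0 : (0 : ℝ) ≤ i := Nat.cast_nonneg i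
  set r : ℝ := ((i : ℝ) + 1) / a with hr
  set w : ℝ := (i + 1 + τ) / a with hw
  have har : a * r = i + 1 := by rw [hr]; field_simp
  have haw : a * w = i + 1 + τ := by rw [hw]; field_simp
  have hr0 : 0 < r := by positivity
  have hur : u ≤ r := by
    rw [← mul_le_mul_iff_right₀ ha0, har]; exact hi2.le
  have hw0 : 0 < w := div_pos (by linarith) ha0
  have hw2 : w ≤ 2 * r := by
    rw [← mul_le_mul_iff_right₀ ha0]; nlinarith
  have hP' : a ^ (α + 1) * |P| ≤ C * r ^ (-(α + 1)) := by
    rw [hr, Real.div_rpow (by positivity) ha0.le, Real.rpow_neg ha0.le, div_inv_eq_mul]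
    have := Real.rpow_pos_of_pos ha0 (α + 1)
    nlinarith [mul_le_mul_of_nonneg_left hP this.le]
  have hrpos := Real.rpow_pos_of_pos hr0 (-(α + 1))
  rw [norm_mul, norm_mul, Real.norm_of_nonneg (Real.rpow_nonneg ha0.le _), ← mul_assoc,
    Real.norm_eq_abs, Real.norm_eq_abs]
  have t1 : 0 ≤ (Set.Ioc 0 (y + 1)).indicator
      (fun u => 2 * (C * L) * (5⁻¹ : ℝ) ^ (-γ) * (u ^ (-α) * |y - u| ^ (-γ))) u :=
    Set.indicator_nonneg (fun v hv => by have := hv.1; positivity) _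
  have t2 : 0 ≤ C * L * (2⁻¹ : ℝ) ^ (-(α + 1)) * (u + y / 2) ^ (-(α + 1)) := by positivity
  rcases lt_or_ge w y with hwy | hwy
  · have hg := hgap (by rw [← haw]; exact mul_lt_mul_of_pos_left hwy ha0)
    have hu1 : u ≤ y + 1 := by
      rw [← mul_le_mul_iff_right₀ ha0]; nlinarith
    have hyw : |y - u| / 5 ≤ y - w := by
      rw [div_le_iff₀ (by norm_num), abs_le]
      constructor
      · rw [← mul_le_mul_iff_right₀ ha0]; nlinarith
      · rw [← mul_le_mul_iff_right₀ ha0]; nlinarith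
    have hyu : 0 < |y - u| := abs_pos.2 (sub_ne_zero.2 huy.symm)
    have e1 : (y - w) ^ (-γ) ≤ (5⁻¹ : ℝ) ^ (-γ) * |y - u| ^ (-γ) := by
      rw [← Real.mul_rpow (by norm_num) hyu.le, mul_comm, ← div_eq_mul_inv]
      exact Real.rpow_le_rpow_of_nonpos (by positivity) hyw (by linarith)
    have e2 : r ^ (-(α + 1)) * r ≤ u ^ (-α) := by
      rw [← Real.rpow_add_one hr0.ne', show -(α + 1) + 1 = -α by ring]
      exact Real.rpow_le_rpow_of_nonpos hu hur (by linarith)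
    rw [stepBound, Set.indicator_of_mem (show u ∈ Set.Ioc 0 (y + 1) from ⟨hu, hu1⟩)]
    refine le_trans ?_ (le_add_of_nonneg_right t2)
    have hyw0 : 0 ≤ (y - w) ^ (-γ) := Real.rpow_nonneg (by linarith) _
    calc a ^ (α + 1) * |P| * |h w| ≤ C * r ^ (-(α + 1)) * (L * (w * (y - w) ^ (-γ))) := by
          gcongr
          exact hb1 w hw0 hwy
      _ ≤ C * r ^ (-(α + 1)) * (L * (2 * r * (y - w) ^ (-γ))) := by gcongr
      _ = 2 * (C * L) * ((r ^ (-(α + 1)) * r) * (y - w) ^ (-γ)) := by ring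
      _ ≤ 2 * (C * L) * (u ^ (-α) * ((5⁻¹ : ℝ) ^ (-γ) * |y - u| ^ (-γ))) := by gcongr
      _ = _ := by ring
  · refine le_trans ?_ (le_add_of_nonneg_left t1)
    have e1 : r ^ (-(α + 1)) ≤ (2⁻¹ : ℝ) ^ (-(α + 1)) * (u + y / 2) ^ (-(α + 1)) := by
      rw [← Real.mul_rpow (by norm_num) (by positivity)]
      exact Real.rpow_le_rpow_of_nonpos (by positivity) (by linarith) (by linarith)
    calc a ^ (α + 1) * |P| * |h w| ≤ C * r ^ (-(α + 1)) * L := by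
          gcongr
          exact hb2 w hwy
      _ = C * L * r ^ (-(α + 1)) := by ring
      _ ≤ C * L * ((2⁻¹ : ℝ) ^ (-(α + 1)) * (u + y / 2) ^ (-(α + 1))) := by gcongr
      _ = _ := by ring

lemma summable_mul_comp_add_div {s κ y L a τ : ℝ} {p : ℕ → ℝ} {h : ℝ → ℝ} (hs : 1 < s)
    (hp : Tendsto (fun i : ℕ => ((i : ℝ) + 1) ^ s * p i) atTop (nhds κ))
    (hb2 : ∀ v, y ≤ v → |h v| ≤ L) (ha : 0 < a) :
    Summable fun i : ℕ => p i * h ((i + 1 + τ) / a) := by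
  obtain ⟨C, hC0, hC⟩ := exists_abs_le_of_tendsto_rpow_mul hp
  refine Summable.of_norm_bounded_eventually_nat
    (((summable_rpow_neg_add_one hs).mul_left C).mul_right L) ?_
  have ht : Tendsto (fun i : ℕ => ((i : ℝ) + 1 + τ) / a) atTop atTop := by
    refine Tendsto.atTop_div_const ha ?_
    exact tendsto_atTop_add_const_right _ _
      (tendsto_atTop_add_const_right _ _ tendsto_natCast_atTop_atTop)
  filter_upwards [ht.eventually_ge_atTop y] with i hi
  rw [norm_mul]
  exact mul_le_mul (hC i) (hb2 _ hi) (norm_nonneg _) (by positivity)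

lemma tendsto_rpow_mul_tsum {α γ κ y L : ℝ} {p : ℕ → ℝ} {h : ℝ → ℝ} {a τ : ℕ → ℝ}
    (hα0 : 0 < α) (hα : α < 1) (hγ0 : 0 ≤ γ) (hγ : γ < 1) (hy : 0 < y)
    (hp : Tendsto (fun i : ℕ => ((i : ℝ) + 1) ^ (α + 1) * p i) atTop (nhds κ))
    (hb1 : ∀ v, 0 < v → v < y → |h v| ≤ L * (v * (y - v) ^ (-γ)))
    (hb2 : ∀ v, y ≤ v → |h v| ≤ L)
    (hc : ∀ v, 0 < v → v ≠ y → ContinuousAt h v)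
    (ha : Tendsto a atTop atTop) (hτ : ∀ N, |τ N| < 1)
    (hgap : ∀ᶠ N in atTop, ∀ i : ℕ, (i : ℝ) + 1 + τ N < a N * y →
      (i : ℝ) + 1 + τ N + 1 / 2 ≤ a N * y) :
    IntegrableOn (fun u => κ * u ^ (-(α + 1)) * h u) (Set.Ioi 0) ∧
    Tendsto (fun N => a N ^ α * ∑' i : ℕ, p i * h ((i + 1 + τ N) / a N)) atTop
      (nhds (∫ u in Set.Ioi 0, κ * u ^ (-(α + 1)) * h u)) := by
  obtain ⟨C, hC0, hC⟩ := exists_abs_le_of_tendsto_rpow_mul hp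
  set g : ℕ → ℕ → ℝ := fun N i => a N ^ (α + 1) * (p i * h ((i + 1 + τ N) / a N)) with hg
  have hmeas : ∀ N, AEStronglyMeasurable (fun u : ℝ => g N ⌊a N * u⌋₊)
      (volume.restrict (Set.Ioi 0)) := fun N =>
    ((measurable_from_nat (f := g N)).comp (Nat.measurable_floor.comp
      (measurable_const.mul measurable_id))).aestronglyMeasurable
  have hB := integrableOn_stepBound hα0 hα hγ0 hγ hy (C * L)
  have hbound : ∀ᶠ N in atTop, ∀ᵐ u ∂(volume.restrict (Set.Ioi 0)),
      ‖g N ⌊a N * u⌋₊‖ ≤ stepBound α γ y (C * L) u := by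
    filter_upwards [hgap, ha.eventually_ge_atTop 1] with N hN haN
    refine (ae_restrict_iff' measurableSet_Ioi).2 ?_
    filter_upwards [Measure.ae_ne volume y] with u huy hu
    have hu0 : 0 < u := hu
    exact norm_step_le_stepBound hα0 hγ0 hy hC0 hb1 hb2 haN (hτ N) hu huy
      (Nat.floor_le (by positivity)) (Nat.lt_floor_add_one _) (hC _) (hN _)
  have hlim : ∀ᵐ u ∂(volume.restrict (Set.Ioi 0)),
      Tendsto (fun N => g N ⌊a N * u⌋₊) atTop (nhds (κ * u ^ (-(α + 1)) * h u)) := by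
    refine (ae_restrict_iff' measurableSet_Ioi).2 ?_
    filter_upwards [Measure.ae_ne volume y] with u huy hu
    have hu0 : 0 < u := hu
    have hinv : Tendsto (fun N => (a N)⁻¹) atTop (nhds 0) := tendsto_inv_atTop_zero.comp ha
    have hr : Tendsto (fun N => ((⌊a N * u⌋₊ : ℝ) + 1) / a N) atTop (nhds u) := by
      have h1 := (tendsto_nat_floor_mul_div_atTop hu0.le).comp ha
      have h2 := h1.add hinv
      rw [add_zero] at h2
      refine h2.congr fun N => ?_
      simp only [Function.comp_apply]
      rw [mul_comm u, add_div, one_div]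
    have hw : Tendsto (fun N => ((⌊a N * u⌋₊ : ℝ) + 1 + τ N) / a N) atTop (nhds u) := by
      have h1 : Tendsto (fun N => τ N * (a N)⁻¹) atTop (nhds 0) := by
        refine squeeze_zero_norm' ?_ hinv
        filter_upwards [ha.eventually_ge_atTop 1] with N haN
        have : 0 ≤ (a N)⁻¹ := by positivity
        rw [norm_mul, Real.norm_of_nonneg this]
        exact mul_le_of_le_one_left this (hτ N).le
      have h2 := hr.add h1
      rw [add_zero] at h2
      refine h2.congr fun N => ?_
      ring
    have hfl : Tendsto (fun N => ⌊a N * u⌋₊) atTop atTop :=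
      tendsto_nat_floor_atTop.comp (ha.atTop_mul_const hu0)
    have hmain := ((hp.comp hfl).mul (hr.rpow_const (p := -(α + 1)) (Or.inl hu0.ne'))).mul
      ((hc u hu0 huy).tendsto.comp hw)
    refine hmain.congr' ?_
    filter_upwards [ha.eventually_gt_atTop 0] with N haN
    simp only [Function.comp_apply, hg]
    have hpos : (0 : ℝ) < (⌊a N * u⌋₊ : ℝ) + 1 := by positivity
    have h1 := (Real.rpow_pos_of_pos hpos (α + 1)).ne'
    rw [Real.div_rpow hpos.le haN.le, Real.rpow_neg hpos.le, Real.rpow_neg haN.le]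
    field_simp
  refine ⟨⟨aestronglyMeasurable_of_tendsto_ae atTop hmeas hlim, ?_⟩, ?_⟩
  · obtain ⟨N₀, hN₀⟩ := eventually_atTop.1 hbound
    refine hasFiniteIntegral_of_dominated_convergence
      (F := fun N u => g (N + N₀) ⌊a (N + N₀) * u⌋₊) hB.hasFiniteIntegral
      (fun N => hN₀ _ (Nat.le_add_left _ _)) ?_
    filter_upwards [hlim] with u hu
    exact hu.comp (tendsto_add_atTop_nat N₀)
  · have h1 := tendsto_integral_filter_of_dominated_convergence (stepBound α γ y (C * L))
      (Eventually.of_forall hmeas) hbound hB hlim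
    refine h1.congr' ?_
    filter_upwards [hbound, ha.eventually_gt_atTop 0] with N hN haN
    have hsum : Summable (g N) :=
      (summable_mul_comp_add_div (by linarith : 1 < α + 1) hp hb2 haN).mul_left _
    rw [integral_Ioi_comp_natFloor_mul haN hsum (Integrable.mono' hB (hmeas N) hN), tsum_mul_left,
      Real.rpow_add_one haN.ne']
    field_simp

/-- The increment `v ↦ f (x - v) - f x`, where `f` is extended by zero to `(-∞, 0]`. -/
noncomputable def leftIncrement (f : ℝ → ℝ) (x v : ℝ) : ℝ :=
  (if v < x then f (x - v) else 0) - f x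

lemma LocLip01.comp_one_sub {f : ℝ → ℝ} (hf : LocLip01 f) : LocLip01 fun t => f (1 - t) := by
  intro a b ha hab hb
  obtain ⟨K, hK⟩ := hf (1 - b) (1 - a) (by linarith) (by linarith) (by linarith)
  refine ⟨K, fun z hz z' hz' => ?_⟩
  have := hK (1 - z) ⟨by linarith [hz.2], by linarith [hz.1]⟩ (1 - z')
    ⟨by linarith [hz'.2], by linarith [hz'.1]⟩
  rwa [show 1 - z - (1 - z') = z' - z by ring, abs_sub_comm z' z] at this

lemma LocLip01.continuousAt {f : ℝ → ℝ} (hf : LocLip01 f) {s : ℝ} (hs : s ∈ Set.Ioo (0 : ℝ) 1) :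
    ContinuousAt f s := by
  obtain ⟨hs0, hs1⟩ := hs
  obtain ⟨K, hK⟩ := hf (s / 2) ((s + 1) / 2) (by linarith) (by linarith) (by linarith)
  refine continuousAt_of_locally_lipschitz (r := min (s / 2) ((1 - s) / 2))
    (by apply lt_min <;> linarith) K fun z hz => ?_
  rw [Real.dist_eq] at hz
  obtain ⟨h1, h2⟩ := lt_min_iff.1 hz
  have h1' := abs_lt.1 h1
  have h2' := abs_lt.1 h2
  exact hK z ⟨by linarith, by linarith⟩ s ⟨by linarith, by linarith⟩

lemma continuousAt_leftIncrement {f : ℝ → ℝ} (hf : LocLip01 f) {x : ℝ} (hx : x < 1) {v : ℝ}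
    (hv : 0 < v) (hvx : v ≠ x) : ContinuousAt (leftIncrement f x) v := by
  rcases lt_or_gt_of_ne hvx with h | h
  · have h1 : ContinuousAt (fun v => f (x - v) - f x) v := by
      refine ContinuousAt.sub (ContinuousAt.comp (f := fun v => x - v) (g := f) ?_ (by fun_prop))
        continuousAt_const
      exact hf.continuousAt ⟨by linarith, by linarith⟩
    refine h1.congr ?_
    filter_upwards [Iio_mem_nhds h] with u hu
    rw [leftIncrement, if_pos (Set.mem_Iio.1 hu)]
  · have h1 : ContinuousAt (fun _ : ℝ => 0 - f x) v := continuousAt_const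
    refine h1.congr ?_
    filter_upwards [Ioi_mem_nhds h] with u hu
    rw [leftIncrement, if_neg (not_lt.2 (Set.mem_Ioi.1 hu).le)]

lemma exists_leftIncrement_bound {f : ℝ → ℝ} (hf : LocLip01 f) {γ : ℝ} (hγ : 0 ≤ γ)
    (hO : f =O[nhdsWithin 0 (Set.Ioi 0)] fun t : ℝ => t ^ (-γ)) {x : ℝ}
    (hx : x ∈ Set.Ioo (0 : ℝ) 1) :
    ∃ L, (∀ v, 0 < v → v < x → |leftIncrement f x v| ≤ L * (v * (x - v) ^ (-γ))) ∧
      ∀ v, x ≤ v → |leftIncrement f x v| ≤ L := by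
  obtain ⟨hx0, hx1⟩ := hx
  obtain ⟨M, hM0, hM⟩ := hO.exists_pos
  obtain ⟨δ, hδ0, hδ⟩ := mem_nhdsGT_iff_exists_Ioo_subset.1 hM.bound
  have hδ0' : 0 < δ := hδ0
  set η := min (δ / 2) (x / 2) with hη
  have hη0 : 0 < η := lt_min (by linarith) (by linarith)
  have hηδ : η < δ := (min_le_left _ _).trans_lt (by linarith)
  have hηx : η ≤ x / 2 := min_le_right _ _
  obtain ⟨K, hK⟩ := hf η x hη0 (by linarith) hx1
  have one_le : ∀ s, 0 < s → s < x → 1 ≤ s ^ (-γ) := fun s h0 h1 =>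
    Real.one_le_rpow_of_pos_of_le_one_of_nonpos h0 (by linarith) (by linarith)
  refine ⟨|K| + (M + |f x|) * (2 / x) + |f x|, fun v hv0 hvx => ?_, fun v hv => ?_⟩
  · rw [leftIncrement, if_pos hvx]
    have h1 := one_le (x - v) (by linarith) (by linarith)
    have hA : 0 ≤ (M + |f x|) * (2 / x) := by positivity
    rcases lt_or_ge (x - v) η with hlt | hge
    · have h2 : |f (x - v)| ≤ M * (x - v) ^ (-γ) := by
        have := hδ (show x - v ∈ Set.Ioo 0 δ from ⟨by linarith, by linarith⟩)
        simpa [Real.norm_eq_abs, abs_of_pos (show 0 < (x - v) ^ (-γ) by linarith)] using this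
      have h3 : 1 ≤ 2 / x * v := by
        rw [div_mul_eq_mul_div, le_div_iff₀ hx0]; linarith
      calc |f (x - v) - f x| ≤ |f (x - v)| + |f x| := abs_sub _ _
        _ ≤ M * (x - v) ^ (-γ) + |f x| * (x - v) ^ (-γ) := by
          gcongr
          exact le_mul_of_one_le_right (abs_nonneg _) h1
        _ = (M + |f x|) * 1 * (x - v) ^ (-γ) := by ring
        _ ≤ (M + |f x|) * (2 / x * v) * (x - v) ^ (-γ) := by gcongr
        _ = (0 + (M + |f x|) * (2 / x) + 0) * (v * (x - v) ^ (-γ)) := by ring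
        _ ≤ _ := by gcongr <;> positivity
    · have h2 := hK (x - v) ⟨hge, by linarith⟩ x ⟨by linarith, le_rfl⟩
      rw [show x - v - x = -v by ring, abs_neg, abs_of_pos hv0] at h2
      calc |f (x - v) - f x| ≤ |K| * v := h2.trans (by gcongr; exact le_abs_self K)
        _ ≤ |K| * (v * (x - v) ^ (-γ)) := by
          gcongr
          exact le_mul_of_one_le_right hv0.le h1
        _ ≤ _ := by
          gcongr
          linarith [abs_nonneg (f x)]
  · rw [leftIncrement, if_neg (not_lt.2 hv), zero_sub, abs_neg]
    have : 0 ≤ (M + |f x|) * (2 / x) := by positivity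
    linarith [abs_nonneg K]

lemma integral_leftIncrement {f : ℝ → ℝ} {α κ x : ℝ} (hα : 0 < α) (hx : 0 < x)
    (hi : IntegrableOn (fun u => κ * u ^ (-(α + 1)) * leftIncrement f x u) (Set.Ioi 0)) :
    ∫ u in Set.Ioi 0, κ * u ^ (-(α + 1)) * leftIncrement f x u =
      κ * ((∫ t in (0 : ℝ)..x, (x - t) ^ (-α - 1) * (f t - f x)) - f x * (x ^ (-α) / α)) := by
  rw [← Set.Ioc_union_Ioi_eq_Ioi hx.le] at hi ⊢
  rw [setIntegral_union (Set.Ioc_disjoint_Ioi le_rfl) measurableSet_Ioi hi.left_of_union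
    hi.right_of_union, mul_sub]
  have e1 : ∫ u in Set.Ioc 0 x, κ * u ^ (-(α + 1)) * leftIncrement f x u =
      κ * ∫ t in (0 : ℝ)..x, (x - t) ^ (-α - 1) * (f t - f x) := by
    rw [← intervalIntegral.integral_of_le hx.le, ← intervalIntegral.integral_const_mul]
    have h := intervalIntegral.integral_comp_sub_left (a := 0) (b := x)
      (fun u => κ * u ^ (-(α + 1)) * leftIncrement f x u) x
    rw [sub_self, sub_zero] at h
    rw [← h, intervalIntegral.integral_of_le hx.le, intervalIntegral.integral_of_le hx.le]
    refine setIntegral_congr_fun measurableSet_Ioc fun t ht => ?_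
    simp only [leftIncrement, sub_lt_self_iff, if_pos ht.1, sub_sub_cancel]
    rw [show -(α + 1) = -α - 1 by ring, mul_assoc]
  have e2 : ∫ u in Set.Ioi x, κ * u ^ (-(α + 1)) * leftIncrement f x u =
      -(κ * (f x * (x ^ (-α) / α))) := by
    have h : ∫ u in Set.Ioi x, κ * u ^ (-(α + 1)) * leftIncrement f x u =
        ∫ u in Set.Ioi x, (-(κ * f x)) * u ^ (-(α + 1)) := by
      refine setIntegral_congr_fun measurableSet_Ioi fun u hu => ?_
      simp only [leftIncrement, if_neg (not_lt.2 (Set.mem_Ioi.1 hu).le)]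
      ring
    rw [h, integral_const_mul, integral_Ioi_rpow_of_lt (by linarith) hx,
      show -(α + 1) + 1 = -α by ring]
    field_simp
  rw [e1, e2, ← sub_eq_add_neg]

/-- `Xvec f N`, extended by zero to all integers. -/
noncomputable def zeroExtend (f : ℝ → ℝ) (N : ℕ) (l : ℤ) : ℝ :=
  if 0 < l ∧ l < N then f (l / N) else 0

lemma hasSum_realPhiHat_mul {α : ℝ} (hα : 0 < α) (f : ℝ → ℝ) (N : ℕ) (k : ℤ) (c : ℝ) :
    HasSum (fun n : ℤ => realPhiHat α n * (zeroExtend f N (k - n) - c))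
      (∑ l ∈ Finset.range (N + 1), realPhiHat α (k - l) * Xvec f N l) := by
  have h1 : HasSum (fun l : ℤ => realPhiHat α (k - l) * zeroExtend f N l)
      (∑ l ∈ Finset.range (N + 1), realPhiHat α (k - l) * Xvec f N l) := by
    refine (Function.Injective.hasSum_iff (g := ((↑) : ℕ → ℤ)) Nat.cast_injective ?_).1 ?_
    · intro l hl
      have : ¬ (0 < l ∧ l < N) := fun h => hl ⟨l.toNat, Int.toNat_of_nonneg h.1.le⟩
      rw [zeroExtend, if_neg this, mul_zero]
    · have e : ∀ l ∈ Finset.range (N + 1), realPhiHat α (k - l) * Xvec f N l =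
          ((fun l : ℤ => realPhiHat α (k - l) * zeroExtend f N l) ∘ ((↑) : ℕ → ℤ)) l := by
        intro l hl
        have hl' : l < N + 1 := by simpa using hl
        simp only [Function.comp_apply, Xvec, zeroExtend]
        by_cases h : l = 0 ∨ l = N
        · rw [if_pos h, if_neg (by omega)]
        · rw [if_neg h, if_pos (by omega)]
          simp
      rw [Finset.sum_congr rfl e]
      refine hasSum_sum_of_ne_finset_zero fun l hl => ?_
      have hl' : ¬ l < N + 1 := by simpa using hl
      simp only [Function.comp_apply, zeroExtend]
      rw [if_neg (by omega), mul_zero]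
  have h2 := (Equiv.subLeft k).hasSum_iff.2 h1
  have h3 := h2.sub ((hasSum_realPhiHat hα).mul_right c)
  rw [zero_mul, sub_zero] at h3
  refine (congrArg (HasSum · _) (funext fun n => ?_)).mp h3
  simp [mul_sub]

lemma zeroExtend_sub_eq_leftIncrement {f : ℝ → ℝ} {N : ℕ} (hN : 0 < N) {x : ℝ} {k : ℤ}
    (hk : (k : ℝ) ≤ N * x) (hx : x < 1) (i : ℕ) :
    zeroExtend f N (k - (i + 1)) - f x =
      leftIncrement f x ((i + 1 + (N * x - k)) / N) := by
  have hN' : (0 : ℝ) < N := by exact_mod_cast hN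
  have hkN : k < N := by
    have : (k : ℝ) < N := hk.trans_lt (by nlinarith)
    exact_mod_cast this
  rw [leftIncrement, zeroExtend]
  congr 1
  have hiff : ((i : ℝ) + 1 + (N * x - k)) / N < x ↔ 0 < k - ((i : ℤ) + 1) := by
    rw [div_lt_iff₀ hN', ← Int.cast_pos (R := ℝ)]
    push_cast
    constructor <;> intro <;> linarith
  by_cases h : 0 < k - ((i : ℤ) + 1)
  · rw [if_pos ⟨h, by omega⟩, if_pos (hiff.2 h)]
    congr 1
    push_cast
    field_simp
    ring
  · rw [if_neg (fun h' => h h'.1), if_neg (fun h' => h (hiff.1 h'))]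

lemma zeroExtend_sub_eq_leftIncrement_reflect {f : ℝ → ℝ} {N : ℕ} (hN : 0 < N) {x : ℝ} {k : ℤ}
    (hk : 0 ≤ k) (i : ℕ) :
    zeroExtend f N (k + (i + 1)) - f x =
      leftIncrement (fun t => f (1 - t)) (1 - x) ((i + 1 - (N * x - k)) / N) := by
  have hN' : (0 : ℝ) < N := by exact_mod_cast hN
  rw [leftIncrement, zeroExtend, sub_sub_cancel]
  congr 1
  have hiff : ((i : ℝ) + 1 - (N * x - k)) / N < 1 - x ↔ k + ((i : ℤ) + 1) < N := by
    rw [div_lt_iff₀ hN', ← Int.cast_lt (R := ℝ)]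
    push_cast
    constructor <;> intro <;> linarith
  by_cases h : k + ((i : ℤ) + 1) < N
  · rw [if_pos ⟨by omega, h⟩, if_pos (hiff.2 h)]
    congr 1
    push_cast
    field_simp
    ring
  · rw [if_neg (fun h' => h h'.2), if_neg (fun h' => h (hiff.1 h'))]

lemma floor_offset_mem_Ico (y : ℝ) : 0 ≤ y - ⌊y⌋ ∧ y - ⌊y⌋ < 1 :=
  ⟨sub_nonneg.2 (Int.floor_le y), by linarith [Int.lt_floor_add_one y]⟩

lemma tendsto_left_sum {f : ℝ → ℝ} {α γ x : ℝ} (hα0 : 0 < α) (hα : α < 1) (hlip : LocLip01 f)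
    (hγ0 : 0 ≤ γ) (hγ : γ < 1)
    (hO : f =O[nhdsWithin 0 (Set.Ioi 0)] fun t : ℝ => t ^ (-γ)) (hx : x ∈ Set.Ioo (0 : ℝ) 1) :
    Tendsto (fun N : ℕ => (N : ℝ) ^ α * ∑' i : ℕ, realPhiHat α ((i + 1 : ℕ) : ℤ) *
        (zeroExtend f N (⌊(N : ℝ) * x⌋ - (i + 1)) - f x)) atTop
      (nhds (2 ^ α / Real.Gamma (-α) *
        ((∫ t in (0 : ℝ)..x, (x - t) ^ (-α - 1) * (f t - f x)) - f x * (x ^ (-α) / α)))) := by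
  obtain ⟨L, hb1, hb2⟩ := exists_leftIncrement_bound hlip hγ0 hO hx
  have h := tendsto_rpow_mul_tsum (a := fun N : ℕ => (N : ℝ))
    (τ := fun N : ℕ => (N : ℝ) * x - ⌊(N : ℝ) * x⌋) hα0 hα hγ0 hγ hx.1
    (tendsto_rpow_mul_realPhiHat hα0) hb1 hb2
    (fun v hv hvx => continuousAt_leftIncrement hlip hx.2 hv hvx) tendsto_natCast_atTop_atTop
    (fun N => by
      obtain ⟨h1, h2⟩ := floor_offset_mem_Ico ((N : ℝ) * x)
      rwa [abs_of_nonneg h1])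
    (Eventually.of_forall fun N i hi => by
      have h1 : (i : ℤ) + 1 < ⌊(N : ℝ) * x⌋ := by
        have : ((i : ℝ) + 1) < ⌊(N : ℝ) * x⌋ := by linarith
        exact_mod_cast this
      have h2 : (i : ℝ) + 1 + 1 ≤ ⌊(N : ℝ) * x⌋ := by exact_mod_cast Int.add_one_le_iff.2 h1
      linarith)
  rw [← integral_leftIncrement hα0 hx.1 h.1]
  refine h.2.congr' ?_
  filter_upwards [eventually_gt_atTop 0] with N hN
  congr 1
  refine tsum_congr fun i => ?_
  rw [zeroExtend_sub_eq_leftIncrement hN (Int.floor_le _) hx.2]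

lemma tendsto_right_sum {f : ℝ → ℝ} {α γ x : ℝ} (hα0 : 0 < α) (hα : α < 1) (hlip : LocLip01 f)
    (hγ0 : 0 ≤ γ) (hγ : γ < 1)
    (hO : (fun t => f (1 - t)) =O[nhdsWithin 0 (Set.Ioi 0)] fun t : ℝ => t ^ (-γ))
    (hx : x ∈ Set.Ioo (0 : ℝ) 1) :
    Tendsto (fun N : ℕ => (N : ℝ) ^ α * ∑' i : ℕ, realPhiHat α (-((i + 1 : ℕ) : ℤ)) *
        (zeroExtend f N (⌊(N : ℝ) * x⌋ + (i + 1)) - f x)) atTop (nhds 0) := by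
  have hx' : 1 - x ∈ Set.Ioo (0 : ℝ) 1 := ⟨by linarith [hx.2], by linarith [hx.1]⟩
  have hg := hlip.comp_one_sub
  set D := leftIncrement (fun t => f (1 - t)) (1 - x) with hD
  obtain ⟨L, hb1, hb2⟩ := exists_leftIncrement_bound hg hγ0 hO hx'
  have hp := tendsto_rpow_mul_realPhiHat hα0
  set κ := 2 ^ α / Real.Gamma (-α)
  set κ' := (2⁻¹ : ℝ) ^ (α + 1) * κ
  have hpo : Tendsto (fun j : ℕ => ((j : ℝ) + 1) ^ (α + 1) *
      realPhiHat α ((2 * j + 1 + 1 : ℕ) : ℤ)) atTop (nhds κ') := by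
    have h1 : Tendsto (fun j : ℕ => 2 * j + 1) atTop atTop :=
      tendsto_atTop_mono (fun j => by simp only [id]; omega) tendsto_id
    refine ((hp.comp h1).const_mul ((2⁻¹ : ℝ) ^ (α + 1))).congr fun j => ?_
    simp only [Function.comp_apply]
    rw [← mul_assoc, ← Real.mul_rpow (by norm_num) (by positivity)]
    congr 2
    push_cast
    ring
  have hpe : Tendsto (fun j : ℕ => ((j : ℝ) + 1) ^ (α + 1) *
      realPhiHat α ((2 * j + 1 : ℕ) : ℤ)) atTop (nhds κ') := by
    have h1 : Tendsto (fun j : ℕ => 2 * j) atTop atTop :=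
      tendsto_atTop_mono (fun j => by simp only [id]; omega) tendsto_id
    have h2 : Tendsto (fun j : ℕ => 2⁻¹ * (1 + 1 / ((2 * j : ℕ) + 1 : ℝ))) atTop
        (nhds (2⁻¹ * (1 + 0))) :=
      (tendsto_const_nhds.add (tendsto_one_div_add_atTop_nhds_zero_nat.comp h1)).const_mul _
    rw [add_zero, mul_one] at h2
    refine ((h2.rpow_const (p := α + 1) (by norm_num)).mul (hp.comp h1)).congr fun j => ?_
    simp only [Function.comp_apply]
    rw [← mul_assoc, ← Real.mul_rpow (by positivity) (by positivity)]
    congr 2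
    push_cast
    field_simp
    ring
  have ha : Tendsto (fun N : ℕ => (N : ℝ) / 2) atTop atTop :=
    tendsto_natCast_atTop_atTop.atTop_div_const two_pos
  have hgap : ∀ (N m : ℕ), (m : ℝ) - ((N : ℝ) * x - ⌊(N : ℝ) * x⌋) < N * (1 - x) →
      (m : ℝ) - ((N : ℝ) * x - ⌊(N : ℝ) * x⌋) + 1 ≤ N * (1 - x) := by
    intro N m hm
    have h1 : (m : ℤ) + ⌊(N : ℝ) * x⌋ < N := by
      have : (m : ℝ) + ⌊(N : ℝ) * x⌋ < N := by linarith
      exact_mod_cast this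
    have h2 : (m : ℝ) + ⌊(N : ℝ) * x⌋ + 1 ≤ N := by exact_mod_cast Int.add_one_le_iff.2 h1
    linarith
  have ho := (tendsto_rpow_mul_tsum (a := fun N : ℕ => (N : ℝ) / 2)
    (τ := fun N : ℕ => -((N : ℝ) * x - ⌊(N : ℝ) * x⌋) / 2) hα0 hα hγ0 hγ hx'.1 hpo hb1 hb2
    (fun v hv hvx => continuousAt_leftIncrement hg hx'.2 hv hvx) ha
    (fun N => by
      obtain ⟨h1, h2⟩ := floor_offset_mem_Ico ((N : ℝ) * x)
      rw [abs_lt]; constructor <;> linarith)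
    (Eventually.of_forall fun N i hi => by
      have := hgap N (2 * i + 2) (by push_cast; linarith)
      push_cast at this
      linarith)).2
  have he := (tendsto_rpow_mul_tsum (a := fun N : ℕ => (N : ℝ) / 2)
    (τ := fun N : ℕ => -(1 + ((N : ℝ) * x - ⌊(N : ℝ) * x⌋)) / 2) hα0 hα hγ0 hγ hx'.1 hpe hb1 hb2
    (fun v hv hvx => continuousAt_leftIncrement hg hx'.2 hv hvx) ha
    (fun N => by
      obtain ⟨h1, h2⟩ := floor_offset_mem_Ico ((N : ℝ) * x)
      rw [abs_lt]; constructor <;> linarith)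
    (Eventually.of_forall fun N i hi => by
      have := hgap N (2 * i + 1) (by push_cast; linarith)
      push_cast at this
      linarith)).2
  have hdiff := (ho.sub he).const_mul ((2 : ℝ) ^ α)
  rw [sub_self, mul_zero] at hdiff
  refine hdiff.congr' ?_
  filter_upwards [eventually_gt_atTop 0] with N hN
  have hN' : (0 : ℝ) < N := by exact_mod_cast hN
  set θ := (N : ℝ) * x - ⌊(N : ℝ) * x⌋ with hθ
  have hk : 0 ≤ ⌊(N : ℝ) * x⌋ := Int.floor_nonneg.2 (mul_nonneg hN'.le hx.1.le)
  have hterm : ∀ i : ℕ, realPhiHat α (-((i + 1 : ℕ) : ℤ)) *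
      (zeroExtend f N (⌊(N : ℝ) * x⌋ + (i + 1)) - f x) =
      (-1) ^ (i + 1) * (realPhiHat α ((i + 1 : ℕ) : ℤ) * D ((i + 1 - θ) / N)) := by
    intro i
    rw [realPhiHat_neg_natCast, zeroExtend_sub_eq_leftIncrement_reflect hN hk, ← hD, mul_assoc]
  have eo : ∀ j : ℕ, realPhiHat α ((2 * j + 1 + 1 : ℕ) : ℤ) *
      D (((2 * j + 1 : ℕ) + 1 - θ) / N) =
      realPhiHat α ((2 * j + 1 + 1 : ℕ) : ℤ) * D ((j + 1 + -θ / 2) / (N / 2)) := by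
    intro j
    congr 2
    push_cast
    field_simp
    ring
  have ee : ∀ j : ℕ, realPhiHat α ((2 * j + 1 : ℕ) : ℤ) * D (((2 * j : ℕ) + 1 - θ) / N) =
      realPhiHat α ((2 * j + 1 : ℕ) : ℤ) * D ((j + 1 + -(1 + θ) / 2) / (N / 2)) := by
    intro j
    congr 2
    push_cast
    field_simp
    ring
  have so := summable_mul_comp_add_div (by linarith : 1 < α + 1) hpo hb2 (half_pos hN')
    (τ := -θ / 2)
  have se := summable_mul_comp_add_div (by linarith : 1 < α + 1) hpe hb2 (half_pos hN')
    (τ := -(1 + θ) / 2)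
  have hsplit : ∑' i : ℕ, realPhiHat α (-((i + 1 : ℕ) : ℤ)) *
      (zeroExtend f N (⌊(N : ℝ) * x⌋ + (i + 1)) - f x) =
      (∑' j : ℕ, realPhiHat α ((2 * j + 1 + 1 : ℕ) : ℤ) * D ((j + 1 + -θ / 2) / (N / 2))) -
      ∑' j : ℕ, realPhiHat α ((2 * j + 1 : ℕ) : ℤ) * D ((j + 1 + -(1 + θ) / 2) / (N / 2)) := by
    rw [tsum_congr hterm, sub_eq_add_neg, add_comm, ← tsum_neg]
    have fe : ∀ j : ℕ, (-1) ^ (2 * j + 1) * (realPhiHat α ((2 * j + 1 : ℕ) : ℤ) *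
        D (((2 * j : ℕ) + 1 - θ) / N)) =
        -(realPhiHat α ((2 * j + 1 : ℕ) : ℤ) * D ((j + 1 + -(1 + θ) / 2) / (N / 2))) := by
      intro j
      rw [ee, (odd_two_mul_add_one j).neg_one_pow, neg_one_mul]
    have fo : ∀ j : ℕ, (-1) ^ (2 * j + 1 + 1) * (realPhiHat α ((2 * j + 1 + 1 : ℕ) : ℤ) *
        D (((2 * j + 1 : ℕ) + 1 - θ) / N)) =
        realPhiHat α ((2 * j + 1 + 1 : ℕ) : ℤ) * D ((j + 1 + -θ / 2) / (N / 2)) := by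
      intro j
      rw [eo, (odd_two_mul_add_one j).add_one.neg_one_pow, one_mul]
    rw [← tsum_even_add_odd (f := fun i : ℕ => (-1) ^ (i + 1) *
      (realPhiHat α ((i + 1 : ℕ) : ℤ) * D ((i + 1 - θ) / N)))
      (by simpa only [fe] using se.neg) (by simpa only [fo] using so)]
    simp only [fe, fo]
  rw [hsplit, ← mul_sub, ← mul_assoc, ← Real.mul_rpow two_pos.le (by positivity),
    mul_div_cancel₀ _ two_ne_zero]

lemma tendsto_center_term {f : ℝ → ℝ} {α x : ℝ} (hα : α < 1) (hlip : LocLip01 f)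
    (hx : x ∈ Set.Ioo (0 : ℝ) 1) (c : ℝ) :
    Tendsto (fun N : ℕ => (N : ℝ) ^ α * (c * (zeroExtend f N ⌊(N : ℝ) * x⌋ - f x)))
      atTop (nhds 0) := by
  obtain ⟨hx0, hx1⟩ := hx
  obtain ⟨K, hK⟩ := hlip (x / 2) x (by linarith) (by linarith) hx1
  have h0 : Tendsto (fun N : ℕ => |c| * |K| * (N : ℝ) ^ (-(1 - α))) atTop (nhds 0) := by
    simpa using ((tendsto_rpow_neg_atTop (by linarith : 0 < 1 - α)).comp
      tendsto_natCast_atTop_atTop).const_mul (|c| * |K|)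
  refine squeeze_zero_norm' ?_ h0
  filter_upwards [(tendsto_natCast_atTop_atTop (R := ℝ)).eventually_ge_atTop (2 / x),
    eventually_gt_atTop 0] with N hN hN0
  have hN' : (0 : ℝ) < N := by exact_mod_cast hN0
  obtain ⟨h1, h2⟩ := floor_offset_mem_Ico ((N : ℝ) * x)
  rw [div_le_iff₀ hx0] at hN
  have hkpos : (0 : ℝ) < ⌊(N : ℝ) * x⌋ := by linarith
  have hkN : (⌊(N : ℝ) * x⌋ : ℝ) < N := by nlinarith
  have hd : x - (⌊(N : ℝ) * x⌋ : ℝ) / N = ((N : ℝ) * x - ⌊(N : ℝ) * x⌋) / N := by field_simp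
  have hlo : x / 2 ≤ (⌊(N : ℝ) * x⌋ : ℝ) / N := by
    rw [le_div_iff₀ hN']; linarith
  have hhi : (⌊(N : ℝ) * x⌋ : ℝ) / N ≤ x := by
    rw [div_le_iff₀ hN']; linarith
  rw [zeroExtend, if_pos ⟨by exact_mod_cast hkpos, by exact_mod_cast hkN⟩]
  have h3 := hK _ ⟨hlo, hhi⟩ x ⟨by linarith, le_rfl⟩
  have h4 : |f ((⌊(N : ℝ) * x⌋ : ℝ) / N) - f x| ≤ |K| * (N : ℝ)⁻¹ := by
    refine h3.trans ?_
    gcongr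
    · exact le_abs_self K
    · rw [abs_sub_comm, hd, abs_of_nonneg (div_nonneg h1 hN'.le), div_eq_mul_inv]
      exact mul_le_of_le_one_left (by positivity) h2.le
  have hpos := Real.rpow_pos_of_pos hN' α
  rw [norm_mul, norm_mul, Real.norm_of_nonneg hpos.le, Real.norm_eq_abs, Real.norm_eq_abs]
  calc (N : ℝ) ^ α * (|c| * |f ((⌊(N : ℝ) * x⌋ : ℝ) / N) - f x|)
      ≤ (N : ℝ) ^ α * (|c| * (|K| * (N : ℝ)⁻¹)) := by gcongr
    _ = |c| * |K| * ((N : ℝ) ^ α * (N : ℝ)⁻¹) := by ring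
    _ = _ := by
      rw [← Real.rpow_neg_one, ← Real.rpow_add hN', show α + -1 = -(1 - α) by ring]

lemma sum_realPhiHat_mul_Xvec {α : ℝ} (hα : 0 < α) (f : ℝ → ℝ) (N : ℕ) (k : ℤ) (c : ℝ) :
    ∑ l ∈ Finset.range (N + 1), realPhiHat α (k - l) * Xvec f N l =
      realPhiHat α 0 * (zeroExtend f N k - c) +
      (∑' i : ℕ, realPhiHat α ((i + 1 : ℕ) : ℤ) * (zeroExtend f N (k - (i + 1)) - c)) +
      ∑' i : ℕ, realPhiHat α (-((i + 1 : ℕ) : ℤ)) * (zeroExtend f N (k + (i + 1)) - c) := by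
  have h := hasSum_realPhiHat_mul hα f N k c
  generalize ∑ l ∈ Finset.range (N + 1), realPhiHat α (k - l) * Xvec f N l = S at h ⊢
  set F : ℤ → ℝ := fun n => realPhiHat α n * (zeroExtend f N (k - n) - c) with hF
  have s1 : Summable (fun n : ℕ => F n) := h.summable.comp_injective Nat.cast_injective
  have s2 : Summable (fun n : ℕ => F (-((n : ℤ) + 1))) :=
    h.summable.comp_injective (i := fun n : ℕ => -((n : ℤ) + 1)) fun a b hab => by
      simp only [neg_inj, add_left_inj, Nat.cast_inj] at hab
      exact hab
  rw [← h.tsum_eq, tsum_of_nat_of_neg_add_one s1 s2, s1.tsum_eq_zero_add]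
  simp only [hF, Nat.cast_zero, sub_zero, Nat.cast_add, Nat.cast_one, sub_neg_eq_add]

/-- For `α ∈ (0,1)` and `f` locally Lipschitz on `(0,1)` belonging to `L¹_{1-α}((0,1))`,
for every `x ∈ (0,1)` the limit `lim_N N^α Σ_{l=0}^N φ̂_α(⌊Nx⌋-l) X_{N,l}` exists and equals
`(2^α/Γ(-α)) (∫₀^x (x-t)^{-α-1}(f(t)-f(x)) dt - f(x) x^{-α}/α)`. -/
theorem fractional_derivative_of_locLip (α : ℝ) (hα : α ∈ Set.Ioo (0 : ℝ) 1) (f : ℝ → ℝ)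
    (hlip : LocLip01 f) (hmem : MemL1Class α f) (x : ℝ) (hx : x ∈ Set.Ioo (0 : ℝ) 1) :
    Tendsto
      (fun N : ℕ => (((N : ℝ) ^ α : ℝ) : ℂ) *
        ∑ l ∈ Finset.range (N + 1), phiHat α (⌊(N : ℝ) * x⌋ - (l : ℤ)) * ((Xvec f N l : ℝ) : ℂ))
      atTop
      (nhds ((((2 : ℝ) ^ α / Real.Gamma (-α) *
        ((∫ t in (0 : ℝ)..x, (x - t) ^ (-α - 1) * (f t - f x)) - f x * (x ^ (-α) / α)) : ℝ) : ℂ))) := by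
  obtain ⟨hα0, hα1⟩ := hα
  obtain ⟨γ, hγ0, hγ1, hO0, hO1⟩ := hmem
  have hγ : γ < 1 := by linarith
  have hmain := ((tendsto_center_term hα1 hlip hx (realPhiHat α 0)).add
    (tendsto_left_sum hα0 hα1 hlip hγ0 hγ hO0 hx)).add
    (tendsto_right_sum hα0 hα1 hlip hγ0 hγ hO1 hx)
  rw [zero_add, add_zero] at hmain
  refine ((Complex.continuous_ofReal.tendsto _).comp hmain).congr fun N => ?_
  simp only [Function.comp_apply, phiHat_eq_realPhiHat hα0]
  rw [← mul_add, ← mul_add, ← sum_realPhiHat_mul_Xvec hα0]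
  push_cast
  rfl
end
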